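/- arXiv:1801.08503 — 5 statements merged into one kernel-verified Lean document; each statement's English description precedes it below -/
import Mathlib

section
/- Let e⁽¹⁾, e⁽²⁾, e⁽³⁾ be the hexagonal-to-rhombic wells. Then for each pair i, j ∈ {1,2,3} with i ≠ j there exist, up to a change of sign, exactly two unit vectors n¹_{ij}, n²_{ij} ∈ S¹ and corresponding nonzero vectors a¹_{ij}, a²_{ij} ∈ ℝ² \ {0} such that e⁽ⁱ⁾ − e⁽ʲ⁾ = a^k_{ij} ⊙ n^k_{ij} for k ∈ {1,2}. More precisely: n¹_{ij} ≠ ±n²_{ij}, the identities e⁽ⁱ⁾ − e⁽ʲ⁾ = a^k_{ij} ⊙ n^k_{ij} hold for k = 1,2, and whenever a ∈ ℝ² \ {0} and n ∈ S¹ satisfy e⁽ⁱ⁾ − e⁽ʲ⁾ = a ⊙ n, then n = ±n¹_{ij} or n = ±n²_{ij}. -/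
noncomputable section
open MeasureTheory Set
open scoped Matrix

abbrev Euc2 := EuclideanSpace ℝ (Fin 2)

/-- The hexagonal-to-rhombic wells `e⁽¹⁾, e⁽²⁾, e⁽³⁾`. -/
def hexWells : Fin 3 → Matrix (Fin 2) (Fin 2) ℝ :=
  ![!![1, 0; 0, -1],
    (1/2 : ℝ) • !![-1, Real.sqrt 3; Real.sqrt 3, 1],
    (1/2 : ℝ) • !![-1, -Real.sqrt 3; -Real.sqrt 3, 1]]

/-- The set of wells `K = {e⁽¹⁾, e⁽²⁾, e⁽³⁾}`. -/
def hexK : Set (Matrix (Fin 2) (Fin 2) ℝ) := {hexWells 0, hexWells 1, hexWells 2}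

/-- The symmetrised tensor product `a ⊙ n = (1/2)(a nᵀ + n aᵀ)`. -/
def odot (a nv : Euc2) : Matrix (Fin 2) (Fin 2) ℝ :=
  fun i j => (a i * nv j + nv i * a j) / 2

/-- The symmetric part `e(M) = (1/2)(M + Mᵀ)`. -/
def symPart (M : Matrix (Fin 2) (Fin 2) ℝ) : Matrix (Fin 2) (Fin 2) ℝ :=
  (1/2 : ℝ) • (M + Mᵀ)

/-- `A` lies in the interior of the convex hull of the wells, taken within the plane of
symmetric trace-free `2×2` matrices: all barycentric coordinates are positive. -/
def inIntConv (A : Matrix (Fin 2) (Fin 2) ℝ) : Prop :=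
  ∃ lam : Fin 3 → ℝ, (∀ i, 0 < lam i) ∧ (∑ i, lam i) = 1 ∧ A = ∑ i, lam i • hexWells i

def matVec2 (M : Matrix (Fin 2) (Fin 2) ℝ) (x : Euc2) : Euc2 :=
  WithLp.toLp 2 fun i => ∑ j, M i j * x j

def grad2 (w : Euc2 → Euc2) (x : Euc2) : Matrix (Fin 2) (Fin 2) ℝ :=
  fun i j => fderiv ℝ w x (EuclideanSpace.single j 1) i

def fro2 (A : Matrix (Fin 2) (Fin 2) ℝ) : ℝ := Real.sqrt (∑ i, ∑ j, (A i j)^2)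

def distK2 (A : Matrix (Fin 2) (Fin 2) ℝ) (K : Set (Matrix (Fin 2) (Fin 2) ℝ)) : ℝ :=
  sInf ((fun B => fro2 (A - B)) '' K)

theorem key (M : Matrix (Fin 2) (Fin 2) ℝ) (s x y : ℝ) (hs : s ≠ 0) (hxy : x ^ 2 + y ^ 2 = 1)
    (h00 : M 0 0 = -(s * x * y)) (h01 : M 0 1 = s * (x ^ 2 - y ^ 2) / 2)
    (h10 : M 1 0 = s * (x ^ 2 - y ^ 2) / 2) (h11 : M 1 1 = s * x * y) :
    ∃ (n1 n2 a1 a2 : Euc2),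
        ‖n1‖ = 1 ∧ ‖n2‖ = 1 ∧ n1 ≠ n2 ∧ n1 ≠ -n2 ∧ a1 ≠ 0 ∧ a2 ≠ 0 ∧
        M = odot a1 n1 ∧
        M = odot a2 n2 ∧
        ∀ (a nv : Euc2), a ≠ 0 → ‖nv‖ = 1 →
          M = odot a nv →
          (nv = n1 ∨ nv = -n1 ∨ nv = n2 ∨ nv = -n2) := by
  have ext2 : ∀ u v : Euc2, u 0 = v 0 → u 1 = v 1 → u = v := by
    intro u v h0 h1
    ext k
    fin_cases k
    · exact h0
    · exact h1
  have nrm : ∀ u : Euc2, ‖u‖ = 1 ↔ u 0 ^ 2 + u 1 ^ 2 = 1 := by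
    intro u
    rw [EuclideanSpace.norm_eq, Real.sqrt_eq_one]
    simp [Fin.sum_univ_two]
  have ne0 : ∀ u v : Euc2, u 0 * v 0 + u 1 * v 1 = 0 → u 0 ^ 2 + u 1 ^ 2 ≠ 0 → u ≠ v := by
    rintro u v h h' rfl
    exact h' (by linarith)
  refine ⟨!₂[x, y], !₂[-y, x], !₂[-(s * y), s * x], !₂[s * x, s * y], ?_, ?_, ?_, ?_, ?_, ?_, ?_,
    ?_, ?_⟩
  · rw [nrm]; simpa using hxy
  · rw [nrm]; simp; linarith
  · apply ne0
    · simp; ring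
    · simp [hxy]
  · apply ne0
    · simp; ring
    · simp [hxy]
  · apply ne0
    · simp
    · have : (s * y) ^ 2 + (s * x) ^ 2 = s ^ 2 := by linear_combination s ^ 2 * hxy
      simpa [this] using hs
  · apply ne0
    · simp
    · have : (s * x) ^ 2 + (s * y) ^ 2 = s ^ 2 := by linear_combination s ^ 2 * hxy
      simpa [this] using hs
  · ext i j
    fin_cases i <;> fin_cases j <;> simp [odot, h00, h01, h10, h11] <;> ring
  · ext i j
    fin_cases i <;> fin_cases j <;> simp [odot, h00, h01, h10, h11] <;> ring
  · intro a nv _ hn h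
    rw [nrm] at hn
    have e00 := congrFun (congrFun h 0) 0
    have e01 := congrFun (congrFun h 0) 1
    have e11 := congrFun (congrFun h 1) 1
    rw [h00] at e00
    rw [h01] at e01
    rw [h11] at e11
    simp only [odot] at e00 e01 e11
    generalize hu : nv 0 = u at *
    generalize hv : nv 1 = v at *
    have hp : s * ((u * x + v * y) * (u * -y + v * x)) = 0 := by
      linear_combination -v ^ 2 * e00 + 2 * u * v * e01 - u ^ 2 * e11
    rcases mul_eq_zero.1 ((mul_eq_zero.1 hp).resolve_left hs) with h1 | h1
    · have hq : (-u * y + v * x - 1) * (-u * y + v * x + 1) = 0 := by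
        linear_combination (x ^ 2 + y ^ 2) * hn + hxy - (u * x + v * y) * h1
      rcases mul_eq_zero.1 hq with h2 | h2
      · right; right; left
        apply ext2
        · simp [hu]; linear_combination x * h1 - y * h2 - u * hxy
        · simp [hv]; linear_combination y * h1 + x * h2 - v * hxy
      · right; right; right
        apply ext2
        · simp [hu]; linear_combination x * h1 - y * h2 - u * hxy
        · simp [hv]; linear_combination y * h1 + x * h2 - v * hxy
    · have hq : (u * x + v * y - 1) * (u * x + v * y + 1) = 0 := by
        linear_combination (x ^ 2 + y ^ 2) * hn + hxy - (u * -y + v * x) * h1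
      rcases mul_eq_zero.1 hq with h2 | h2
      · left
        apply ext2
        · simp [hu]; linear_combination x * h2 - y * h1 - u * hxy
        · simp [hv]; linear_combination y * h2 + x * h1 - v * hxy
      · right; left
        apply ext2
        · simp [hu]; linear_combination x * h2 - y * h1 - u * hxy
        · simp [hv]; linear_combination y * h2 + x * h1 - v * hxy

/-- For each pair of distinct wells there are, up to sign, exactly two
unit normals `n¹, n²` (with nonzero amplitudes `a¹, a²`) realising the symmetrised
rank-one connection `e⁽ⁱ⁾ − e⁽ʲ⁾ = a ⊙ n`. -/
theorem statement3 :
    ∀ i j : Fin 3, i ≠ j →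
      ∃ (n1 n2 a1 a2 : Euc2),
        ‖n1‖ = 1 ∧ ‖n2‖ = 1 ∧ n1 ≠ n2 ∧ n1 ≠ -n2 ∧ a1 ≠ 0 ∧ a2 ≠ 0 ∧
        hexWells i - hexWells j = odot a1 n1 ∧
        hexWells i - hexWells j = odot a2 n2 ∧
        ∀ (a nv : Euc2), a ≠ 0 → ‖nv‖ = 1 →
          hexWells i - hexWells j = odot a nv →
          (nv = n1 ∨ nv = -n1 ∨ nv = n2 ∨ nv = -n2) := by
  intro i j hij
  have h3 : Real.sqrt 3 ^ 2 = 3 := Real.sq_sqrt (by norm_num)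
  have hs : 2 * Real.sqrt 3 ≠ 0 := by positivity
  have hs' : -(2 * Real.sqrt 3) ≠ 0 := neg_ne_zero.2 hs
  fin_cases i <;> fin_cases j
  · exact absurd rfl hij
  · apply key _ (2 * Real.sqrt 3) (1 / 2) (-(Real.sqrt 3 / 2)) hs <;> simp [hexWells] <;> grind
  · apply key _ (2 * Real.sqrt 3) (Real.sqrt 3 / 2) (-(1 / 2)) hs <;> simp [hexWells] <;> grind
  · apply key _ (-(2 * Real.sqrt 3)) (1 / 2) (-(Real.sqrt 3 / 2)) hs' <;> simp [hexWells] <;> grind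
  · exact absurd rfl hij
  · apply key _ (2 * Real.sqrt 3) 1 0 hs <;> simp [hexWells] <;> grind
  · apply key _ (-(2 * Real.sqrt 3)) (Real.sqrt 3 / 2) (-(1 / 2)) hs' <;> simp [hexWells] <;> grind
  · apply key _ (-(2 * Real.sqrt 3)) 1 0 hs' <;> simp [hexWells] <;> grind
  · exact absurd rfl hij
end
end

section
/- Let e⁽¹⁾, e⁽²⁾, e⁽³⁾ be the hexagonal-to-rhombic wells and K := {e⁽¹⁾, e⁽²⁾, e⁽³⁾}. Then the lamination convex hull of K equals the convex hull of K: K^{lc} = conv(K). In particular, the affine dimension of K^{lc} equals the affine dimension of conv(K), which equals 2. -/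
noncomputable section
open MeasureTheory Set
open scoped Matrix

/-- The iterates `K⁽ᵏ⁾` of the lamination convex hull construction. -/
def lamIter (K : Set (Matrix (Fin 2) (Fin 2) ℝ)) : ℕ → Set (Matrix (Fin 2) (Fin 2) ℝ)
  | 0 => K
  | k + 1 => lamIter K k ∪
      {C | ∃ A ∈ lamIter K k, ∃ B ∈ lamIter K k, ∃ lam ∈ Set.Icc (0:ℝ) 1,
        (∃ (a nv : Euc2), a ≠ 0 ∧ ‖nv‖ = 1 ∧ A - B = odot a nv) ∧
        C = lam • A + (1 - lam) • B}

/-- The lamination convex hull `K^{lc} = ⋃ₖ K⁽ᵏ⁾`. -/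
def lamHull (K : Set (Matrix (Fin 2) (Fin 2) ℝ)) : Set (Matrix (Fin 2) (Fin 2) ℝ) :=
  ⋃ k : ℕ, lamIter K k

/-- The symmetric trace-free matrices. -/
def symTF : Submodule ℝ (Matrix (Fin 2) (Fin 2) ℝ) where
  carrier := {M | M 0 1 = M 1 0 ∧ M 1 1 = - M 0 0}
  add_mem' := by
    rintro A B ⟨h1, h2⟩ ⟨h3, h4⟩
    refine ⟨?_, ?_⟩ <;> simp only [Matrix.add_apply] <;> linarith
  zero_mem' := by simp
  smul_mem' := by
    rintro c A ⟨h1, h2⟩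
    refine ⟨?_, ?_⟩ <;> simp only [Matrix.smul_apply, smul_eq_mul]
    · rw [h1]
    · rw [h2]; ring

theorem odot_normalise (u v : Euc2) (h : odot u v ≠ 0) :
    ∃ (a nv : Euc2), a ≠ 0 ∧ ‖nv‖ = 1 ∧ odot u v = odot a nv := by
  have hu : u ≠ 0 := by
    rintro rfl
    apply h
    ext i j
    simp [odot]
  have hv : v ≠ 0 := by
    rintro rfl
    apply h
    ext i j
    simp [odot]
  have hn : ‖v‖ ≠ 0 := norm_ne_zero_iff.mpr hv
  refine ⟨‖v‖ • u, ‖v‖⁻¹ • v, smul_ne_zero hn hu, ?_, ?_⟩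
  · rw [norm_smul, norm_inv, norm_norm, inv_mul_cancel₀ hn]
  · ext i j
    simp only [odot, PiLp.smul_apply, smul_eq_mul]
    field_simp

theorem symTF_factor (M : Matrix (Fin 2) (Fin 2) ℝ) (hM : M ∈ symTF) :
    ∃ u v : Euc2, M = odot u v := by
  obtain ⟨h1, h2⟩ := hM
  by_cases hp : M 0 0 = 0
  · refine ⟨!₂[0, 2 * M 0 1], !₂[1, 0], ?_⟩
    ext i j
    fin_cases i <;> fin_cases j <;> simp [odot, h1, h2, hp]
  · have hr : Real.sqrt ((M 0 0)^2 + (M 0 1)^2) ^ 2 = (M 0 0)^2 + (M 0 1)^2 :=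
      Real.sq_sqrt (by positivity)
    set r := Real.sqrt ((M 0 0)^2 + (M 0 1)^2)
    refine ⟨!₂[1, (M 0 1 + r) / M 0 0], !₂[M 0 0, M 0 1 - r], ?_⟩
    ext i j
    fin_cases i <;> fin_cases j <;> simp [odot]
    · field_simp; ring
    · rw [← h1]; field_simp; ring
    · rw [h2]; field_simp; linarith

theorem lamIter_mono (K : Set (Matrix (Fin 2) (Fin 2) ℝ)) : Monotone (lamIter K) :=
  monotone_nat_of_le_succ fun _ => Set.subset_union_left

theorem lamHull_subset (K : Set (Matrix (Fin 2) (Fin 2) ℝ)) :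
    lamHull K ⊆ convexHull ℝ K := by
  refine Set.iUnion_subset fun k => ?_
  induction k with
  | zero => exact subset_convexHull ℝ K
  | succ k ih =>
    rintro C (hC | ⟨A, hA, B, hB, l, hl, -, rfl⟩)
    · exact ih hC
    · exact convex_convexHull ℝ K (ih hA) (ih hB) hl.1 (sub_nonneg.mpr hl.2) (by ring)

theorem hexK_subset : hexK ⊆ (symTF : Set (Matrix (Fin 2) (Fin 2) ℝ)) := by
  rintro M (rfl | rfl | rfl) <;> refine ⟨?_, ?_⟩ <;> simp [hexWells]

theorem lamHull_convex : Convex ℝ (lamHull hexK) := by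
  have hsub : lamHull hexK ⊆ (symTF : Set (Matrix (Fin 2) (Fin 2) ℝ)) :=
    (lamHull_subset hexK).trans (convexHull_min hexK_subset symTF.convex)
  intro A hA B hB s t hs ht hst
  by_cases hAB : A = B
  · subst hAB
    rwa [← add_smul, hst, one_smul]
  obtain ⟨u, v, huv⟩ := symTF_factor (A - B) (symTF.sub_mem (hsub hA) (hsub hB))
  obtain ⟨a, n, ha, hn, h⟩ := odot_normalise u v (huv ▸ sub_ne_zero.mpr hAB)
  obtain ⟨i, hi⟩ := Set.mem_iUnion.mp hA
  obtain ⟨j, hj⟩ := Set.mem_iUnion.mp hB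
  refine Set.mem_iUnion.mpr ⟨max i j + 1, Or.inr ⟨A, lamIter_mono hexK (le_max_left i j) hi,
    B, lamIter_mono hexK (le_max_right i j) hj, s, ⟨hs, by linarith⟩,
    ⟨a, n, ha, hn, huv.trans h⟩, ?_⟩⟩
  rw [← hst, add_sub_cancel_left]

theorem lamHull_eq : lamHull hexK = convexHull ℝ hexK := by
  refine (lamHull_subset hexK).antisymm (convexHull_min ?_ lamHull_convex)
  exact Set.subset_iUnion (lamIter hexK) 0

theorem hexK_eq_range : hexK = Set.range hexWells := by
  ext M
  simp [hexK, Fin.exists_fin_succ, eq_comm]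

theorem hexWells_affineIndependent : AffineIndependent ℝ hexWells := by
  rw [affineIndependent_iff]
  intro s w hw h
  have key : ∀ w : Fin 3 → ℝ, ∑ i, w i = 0 → ∑ i, w i • hexWells i = 0 → ∀ i, w i = 0 := by
    intro w hw h
    have h00 := congrFun (congrFun h 0) 0
    have h01 := congrFun (congrFun h 0) 1
    simp [Fin.sum_univ_three, hexWells] at hw h00 h01
    have h3 : Real.sqrt 3 ≠ 0 := by positivity
    have h12 : w 1 = w 2 := by
      have : (w 1 - w 2) * Real.sqrt 3 = 0 := by linarith
      rcases mul_eq_zero.mp this with h | h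
      · linarith
      · exact absurd h h3
    intro i
    fin_cases i <;> simp <;> linarith
  intro i hi
  have := key (fun i => if i ∈ s then w i else 0) (by simpa using hw)
    (by simpa [ite_smul] using h) i
  simpa [hi] using this

theorem finrank_conv : Module.finrank ℝ (vectorSpan ℝ (convexHull ℝ hexK)) = 2 := by
  rw [← direction_affineSpan, affineSpan_convexHull, direction_affineSpan, hexK_eq_range]
  exact hexWells_affineIndependent.finrank_vectorSpan (by simp)

/-- For the hexagonal-to-rhombic wells, the lamination convex hull
coincides with the convex hull, and both have affine dimension `2`. -/
theorem statement5 :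
    lamHull hexK = convexHull ℝ hexK ∧
    Module.finrank ℝ (vectorSpan ℝ (lamHull hexK)) = 2 ∧
    Module.finrank ℝ (vectorSpan ℝ (convexHull ℝ hexK)) = 2 := by
  exact ⟨lamHull_eq, lamHull_eq ▸ finrank_conv, finrank_conv⟩
end
end

section
/- Let K := {e⁽¹⁾, e⁽²⁾, e⁽³⁾} be the hexagonal-to-rhombic wells. Let M ∈ ℝ^{2×2} with e(M) ∈ int conv(K), let ε₀ ∈ (0, dist(e(M), ∂conv(K))/100), and let i ∈ {1,2,3} be such that |e(M) − e⁽ⁱ⁾| ≤ dist(e(M), K) + 4ε₀. Then there exists a rectangular domain Ω_δ(M) ⊂ ℝ² (in general rotated with respect to the coordinate axes) and a Lipschitz function u : ℝ² → ℝ², together with symmetric matrices ẽ₁, …, ẽ₄ ∈ int conv(K), such that: (i) e(∇u) ∈ {e⁽ⁱ⁾, ẽ₁, …, ẽ₄} ⊂ conv(K) a.e. in Ω_δ(M) and the set {x ∈ Ω_δ(M) : e(∇u)(x) = e⁽ⁱ⁾} has Lebesgue measure equal to (1/4)|Ω_δ(M)|; (ii) u(x) = Mx on ℝ² \ Ω_δ(M).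 -/
noncomputable section
open MeasureTheory Set
open scoped Matrix

/-- An open rectangle in the plane (in general rotated with respect to the axes):
the image of the open unit square under translation and a linear map with orthogonal
nonzero columns. -/
def IsOpenRectangle (s : Set Euc2) : Prop :=
  ∃ (c v w : Euc2), v ≠ 0 ∧ w ≠ 0 ∧ (inner ℝ v w : ℝ) = 0 ∧
    s = {y | ∃ a ∈ Set.Ioo (0:ℝ) 1, ∃ b ∈ Set.Ioo (0:ℝ) 1, y = c + a • v + b • w}

/-- The relative boundary `∂ conv(K)` of the convex hull of the wells, within the plane
of symmetric trace-free matrices. -/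
def relBdryConvHexK : Set (Matrix (Fin 2) (Fin 2) ℝ) :=
  convexHull ℝ hexK \ {A | inIntConv A}


lemma hex_sum_entries (l : Fin 3 → ℝ) :
    (∑ k, l k • hexWells k) = !![l 0 - (l 1 + l 2) / 2, Real.sqrt 3 / 2 * (l 1 - l 2);
      Real.sqrt 3 / 2 * (l 1 - l 2), -(l 0 - (l 1 + l 2) / 2)] := by
  ext a b
  fin_cases a <;> fin_cases b <;> simp [Fin.sum_univ_three, hexWells] <;> ring

lemma hex_not_int (k : Fin 3) : ¬ inIntConv (hexWells k) := by
  rintro ⟨l, hl, hs, h⟩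
  rw [hex_sum_entries] at h
  have h00 := congrFun (congrFun h 0) 0
  have h01 := congrFun (congrFun h 0) 1
  have h3 : 0 < Real.sqrt 3 := by positivity
  have h0 := hl 0
  have h1 := hl 1
  have h2 := hl 2
  rw [Fin.sum_univ_three] at hs
  fin_cases k <;> simp [hexWells] at h00 h01
  · linarith
  · have : l 1 - l 2 = 1 := by
      apply mul_left_cancel₀ h3.ne'
      linarith
    linarith
  · have : l 1 - l 2 = -1 := by
      apply mul_left_cancel₀ h3.ne'
      linarith
    linarith

lemma fro2_sq (l : Fin 3 → ℝ) (hs : ∑ k, l k = 1) (k : Fin 3) :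
    fro2 ((∑ k, l k • hexWells k) - hexWells k) ^ 2
      = 3 * ((l 0) ^ 2 + (l 1) ^ 2 + (l 2) ^ 2 + 1 - 2 * l k) := by
  have h3 : Real.sqrt 3 ^ 2 = 3 := Real.sq_sqrt (by norm_num)
  rw [Fin.sum_univ_three] at hs
  have h0 : l 0 = 1 - l 1 - l 2 := by linarith
  rw [hex_sum_entries, fro2, Real.sq_sqrt (by positivity)]
  fin_cases k <;> simp [Fin.sum_univ_two, hexWells, h0] <;> ring_nf <;> rw [h3] <;> ring

lemma bary_bound (A : Matrix (Fin 2) (Fin 2) ℝ) (l : Fin 3 → ℝ) (hl : ∀ k, 0 < l k)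
    (hs : ∑ k, l k = 1) (hA : A = ∑ k, l k • hexWells k) (ε₀ : ℝ)
    (hε₀ : ε₀ ∈ Set.Ioo 0 (distK2 A relBdryConvHexK / 100)) (i : Fin 3)
    (hi : fro2 (A - hexWells i) ≤ distK2 A hexK + 4 * ε₀) : 64 / 225 < l i := by
  have hmem : ∀ j, hexWells j ∈ hexK := by
    intro j; fin_cases j <;> simp [hexK]
  have hbdd : ∀ S : Set (Matrix (Fin 2) (Fin 2) ℝ),
      BddBelow ((fun B => fro2 (A - B)) '' S) := by
    intro S
    refine ⟨0, ?_⟩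
    rintro _ ⟨B, -, rfl⟩
    exact Real.sqrt_nonneg _
  have key : ∀ j, fro2 (A - hexWells i) ^ 2 ≤ (676 / 625) * fro2 (A - hexWells j) ^ 2 := by
    intro j
    have h1 : distK2 A hexK ≤ fro2 (A - hexWells j) :=
      csInf_le (hbdd _) ⟨_, hmem j, rfl⟩
    have h2 : distK2 A relBdryConvHexK ≤ fro2 (A - hexWells j) :=
      csInf_le (hbdd _) ⟨_, ⟨subset_convexHull ℝ _ (hmem j), hex_not_int j⟩, rfl⟩
    have h3 := hε₀.2
    have h4 : 0 ≤ fro2 (A - hexWells i) := Real.sqrt_nonneg _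
    have h5 : fro2 (A - hexWells i) ≤ (26 / 25) * fro2 (A - hexWells j) := by linarith
    calc fro2 (A - hexWells i) ^ 2 ≤ ((26 / 25) * fro2 (A - hexWells j)) ^ 2 :=
          pow_le_pow_left₀ h4 h5 2
      _ = _ := by ring
  subst hA
  simp only [fro2_sq l hs] at key
  have k0 := key 0
  have k1 := key 1
  have k2 := key 2
  have h0 := hl 0
  have h1 := hl 1
  have h2 := hl 2
  rw [Fin.sum_univ_three] at hs
  have hsq : (l 0) ^ 2 + (l 1) ^ 2 + (l 2) ^ 2 ≤ 1 := by nlinarith [mul_pos h0 h1, mul_pos h0 h2, mul_pos h1 h2]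
  by_contra! hcon
  fin_cases i <;> simp at hcon k0 k1 k2
  · rcases le_total (l 1) (l 2) with h | h <;> linarith
  · rcases le_total (l 0) (l 2) with h | h <;> linarith
  · rcases le_total (l 0) (l 1) with h | h <;> linarith

/-- A symmetric trace-free matrix in barycentric increments. -/
lemma tracefree_bary (a b : ℝ) : ∃ r : Fin 3 → ℝ, (∑ k, r k) = 0 ∧
    !![a, b; b, -a] = ∑ k, r k • hexWells k := by
  have h3 : Real.sqrt 3 ^ 2 = 3 := Real.sq_sqrt (by norm_num)
  have h3' : Real.sqrt 3 ≠ 0 := by positivity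
  refine ⟨![2 * a / 3, -a / 3 + b / Real.sqrt 3, -a / 3 - b / Real.sqrt 3], ?_, ?_⟩
  · simp [Fin.sum_univ_three]; ring
  · rw [hex_sum_entries]
    ext c d
    fin_cases c <;> fin_cases d <;> simp <;> field_simp <;> ring

/-- `matVec2 M` as a continuous linear map. -/
def matCLM (M : Matrix (Fin 2) (Fin 2) ℝ) : Euc2 →L[ℝ] Euc2 :=
  LinearMap.toContinuousLinearMap
    { toFun := matVec2 M
      map_add' := by
        intro x y
        ext k
        simp [matVec2, Fin.sum_univ_two]
        ring
      map_smul' := by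
        intro c x
        ext k
        simp [matVec2, Fin.sum_univ_two]
        ring }

lemma matCLM_apply (M : Matrix (Fin 2) (Fin 2) ℝ) (x : Euc2) : matCLM M x = matVec2 M x := rfl

lemma matCLM_single (M : Matrix (Fin 2) (Fin 2) ℝ) (k j : Fin 2) :
    matCLM M (EuclideanSpace.single j 1) k = M k j := by
  rw [matCLM_apply]
  fin_cases j <;> simp [matVec2, Fin.sum_univ_two]

lemma grad2_of_hasFDerivAt {w : Euc2 → Euc2} {x : Euc2} {w' : Euc2 →L[ℝ] Euc2}
    (h : HasFDerivAt w w' x) :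
    grad2 w x = fun i j => w' (EuclideanSpace.single j 1) i := by
  unfold grad2
  rw [h.fderiv]

/-- The unit square. -/
def unitSq : Set Euc2 := {y | y 0 ∈ Ioo (0:ℝ) 1 ∧ y 1 ∈ Ioo (0:ℝ) 1}

lemma unitSq_rect : IsOpenRectangle unitSq := by
  refine ⟨0, EuclideanSpace.single 0 1, EuclideanSpace.single 1 1, ?_, ?_, ?_, ?_⟩
  · intro h
    have := congrArg (fun z : Euc2 => z 0) h
    simp at this
  · intro h
    have := congrArg (fun z : Euc2 => z 1) h
    simp at this
  · simp [PiLp.inner_apply, Fin.sum_univ_two]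
  · ext y
    constructor
    · rintro ⟨h0, h1⟩
      refine ⟨y 0, h0, y 1, h1, ?_⟩
      ext k
      fin_cases k <;> simp
    · rintro ⟨a, ha, b, hb, rfl⟩
      constructor <;> simpa

lemma unitSq_open : IsOpen unitSq := by
  have h : ∀ k : Fin 2, Continuous fun y : Euc2 => y k := fun k => by fun_prop
  exact (isOpen_Ioo.preimage (h 0)).inter (isOpen_Ioo.preimage (h 1))

/-- Scaled copy map. -/
def cpy (a : Euc2 × ℝ) (z : Euc2) : Euc2 := a.1 + a.2 • z

/-- Inverse of the scaled copy map. -/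
def cpyInv (a : Euc2 × ℝ) (x : Euc2) : Euc2 := a.2⁻¹ • (x - a.1)

lemma cpyInv_cpy {a : Euc2 × ℝ} (ha : 0 < a.2) (z : Euc2) : cpyInv a (cpy a z) = z := by
  simp [cpy, cpyInv, smul_smul, inv_mul_cancel₀ ha.ne']

lemma cpy_cpyInv {a : Euc2 × ℝ} (ha : 0 < a.2) (x : Euc2) : cpy a (cpyInv a x) = x := by
  simp [cpy, cpyInv, smul_smul, mul_inv_cancel₀ ha.ne']

lemma cpyInv_cont (a : Euc2 × ℝ) : Continuous (cpyInv a) := by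
  unfold cpyInv; fun_prop

lemma cpy_image {a : Euc2 × ℝ} (ha : 0 < a.2) (S : Set Euc2) :
    cpy a '' S = cpyInv a ⁻¹' S := by
  ext x
  constructor
  · rintro ⟨z, hz, rfl⟩
    rwa [mem_preimage, cpyInv_cpy ha]
  · intro hx
    exact ⟨_, hx, cpy_cpyInv ha x⟩

open scoped Pointwise in
lemma cpy_volume {a : Euc2 × ℝ} (ha : 0 < a.2) (S : Set Euc2) :
    volume (cpy a '' S) = ENNReal.ofReal (a.2 ^ 2) * volume S := by
  have : cpy a '' S = (fun z => a.1 + z) '' (a.2 • S) := by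
    rw [← image_smul, image_image]; rfl
  rw [this, image_add_left, measure_preimage_add, Measure.addHaar_smul]
  simp

lemma assembly (M : Matrix (Fin 2) (Fin 2) ℝ) (V : Euc2 → Euc2) (KV : NNReal)
    (hV : LipschitzWith KV V) (T D : Set Euc2) (hTc : IsClosed T) (R0 : ℝ) (hR0 : 0 < R0)
    (hTb : T ⊆ Metric.closedBall 0 R0) (hTi : (interior T).Nonempty)
    (hV0 : ∀ x, x ∉ T → V x = 0) (hD : MeasurableSet D) (hDT : D ⊆ T)
    (hvol : volume D = volume T / 4) (E : Matrix (Fin 2) (Fin 2) ℝ)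
    (S : Set (Matrix (Fin 2) (Fin 2) ℝ)) (hES : E ∉ S)
    (hgood : ∀ᵐ z ∂(volume : Measure Euc2), z ∈ T → z ∈ interior T ∧ DifferentiableAt ℝ V z ∧
      (z ∈ D → symPart (M + grad2 V z) = E) ∧ (z ∉ D → symPart (M + grad2 V z) ∈ S)) :
    ∃ (Ω : Set Euc2) (u : Euc2 → Euc2) (L : NNReal), IsOpenRectangle Ω ∧ LipschitzWith L u ∧
      (∀ᵐ x ∂(volume : Measure Euc2), x ∈ Ω → symPart (grad2 u x) ∈ insert E S) ∧
      volume {x ∈ Ω | symPart (grad2 u x) = E} = volume Ω / 4 ∧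
      EqOn u (matVec2 M) Ωᶜ := by
  classical
  have hTpos : volume T ≠ 0 := by
    have h1 : 0 < volume (interior T) := isOpen_interior.measure_pos _ hTi
    exact (h1.trans_le (measure_mono interior_subset)).ne'
  have hTfin : volume T ≠ ⊤ :=
    ((measure_mono hTb).trans_lt (Metric.isBounded_closedBall.measure_lt_top)).ne
  have hBfin : volume (Metric.closedBall (0 : Euc2) R0) ≠ ⊤ :=
    (Metric.isBounded_closedBall.measure_lt_top).ne
  set C : ENNReal := 9 * volume (Metric.closedBall (0 : Euc2) R0) / volume T with hC
  have hCfin : C ≠ ⊤ := ENNReal.div_ne_top (ENNReal.mul_ne_top (by norm_num) hBfin) hTpos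
  set tt : Set (Euc2 × ℝ) :=
    {a | 0 < a.2 ∧ Metric.closedBall a.1 (a.2 * R0) ⊆ unitSq} with htt
  have hsub : ∀ a ∈ tt, cpy a '' T ⊆ Metric.closedBall a.1 (a.2 * R0) := by
    rintro a ⟨ha, -⟩ _ ⟨z, hz, rfl⟩
    have := hTb hz
    simp only [Metric.mem_closedBall, dist_zero_right] at this
    simp only [cpy, Metric.mem_closedBall, dist_self_add_left, norm_smul, Real.norm_eq_abs,
      abs_of_pos ha]
    gcongr
  obtain ⟨F, hFt, hFc, hFd, hFcov⟩ := Vitali.exists_disjoint_covering_ae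
    (volume : Measure Euc2) unitSq tt C.toNNReal (fun a => a.2 * R0) (fun a => a.1)
    (fun a => cpy a '' T) hsub
    (by
      rintro a ⟨ha, -⟩
      rw [cpy_volume ha, ENNReal.coe_toNNReal hCfin]
      have : (3 * (a.2 * R0)) = (3 * a.2) * R0 := by ring
      rw [this, Measure.addHaar_closedBall_mul _ _ (by positivity) hR0.le]
      simp only [finrank_euclideanSpace, Fintype.card_fin]
      have h9 : ENNReal.ofReal ((3 * a.2) ^ 2) = 9 * ENNReal.ofReal (a.2 ^ 2) := by
        rw [mul_pow, ENNReal.ofReal_mul (by norm_num)]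
        norm_num
      rw [h9, hC]
      have : 9 * volume (Metric.closedBall (0 : Euc2) R0) / volume T *
          (ENNReal.ofReal (a.2 ^ 2) * volume T) =
          9 * volume (Metric.closedBall (0 : Euc2) R0) * ENNReal.ofReal (a.2 ^ 2) *
          ((volume T)⁻¹ * volume T) := by
        rw [div_eq_mul_inv]; ring
      rw [this, ENNReal.inv_mul_cancel hTpos hTfin]
      apply le_of_eq; ring)
    (by
      rintro a ⟨ha, -⟩
      obtain ⟨z, hz⟩ := hTi
      refine ⟨cpy a z, ?_⟩
      refine interior_maximal (image_mono interior_subset) ?_ ⟨z, hz, rfl⟩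
      rw [cpy_image ha]
      exact isOpen_interior.preimage (cpyInv_cont a))
    (by
      rintro a ⟨ha, -⟩
      rw [cpy_image ha]
      exact hTc.preimage (cpyInv_cont a))
    (by
      intro x hx ε hε
      obtain ⟨η, hη, hball⟩ := Metric.isOpen_iff.1 unitSq_open x hx
      refine ⟨(x, min ε (η / 2) / R0), ⟨by positivity, ?_⟩, ?_, rfl⟩
      · refine (Metric.closedBall_subset_ball ?_).trans hball
        simp only
        rw [div_mul_cancel₀ _ hR0.ne']
        exact (min_le_right _ _).trans_lt (by linarith)
      · simp only
        rw [div_mul_cancel₀ _ hR0.ne']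
        exact min_le_left _ _)
  have hFpos : ∀ a ∈ F, 0 < a.2 := fun a ha => (hFt ha).1
  have hFsq : ∀ a ∈ F, cpy a '' T ⊆ unitSq := fun a ha => (hsub a (hFt ha)).trans (hFt ha).2
  set Va : Euc2 × ℝ → Euc2 → Euc2 := fun a x => a.2 • V (cpyInv a x) with hVa
  have hVa0 : ∀ a ∈ F, ∀ x, x ∉ cpy a '' T → Va a x = 0 := by
    intro a ha x hx
    rw [cpy_image (hFpos a ha)] at hx
    simp only [hVa]
    rw [hV0 _ hx, smul_zero]
  have hVaL : ∀ a ∈ F, ∀ x y, dist (Va a x) (Va a y) ≤ KV * dist x y := by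
    intro a ha x y
    have hp := hFpos a ha
    have h1 := hV.dist_le_mul (cpyInv a x) (cpyInv a y)
    have h2 : dist (cpyInv a x) (cpyInv a y) = a.2⁻¹ * dist x y := by
      simp only [cpyInv, dist_smul₀, dist_sub_right, Real.norm_eq_abs, abs_of_pos (inv_pos.2 hp)]
    simp only [hVa]
    rw [dist_smul₀, Real.norm_eq_abs, abs_of_pos hp]
    rw [h2] at h1
    calc a.2 * dist (V (cpyInv a x)) (V (cpyInv a y)) ≤ a.2 * (KV * (a.2⁻¹ * dist x y)) := by
          gcongr
      _ = KV * dist x y := by field_simp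
  set w : Euc2 → Euc2 := fun x =>
    if h : ∃ a ∈ F, x ∈ cpy a '' T then Va h.choose x else 0 with hw
  have hw1 : ∀ a ∈ F, ∀ x ∈ cpy a '' T, w x = Va a x := by
    intro a ha x hx
    have h : ∃ a ∈ F, x ∈ cpy a '' T := ⟨a, ha, hx⟩
    have hch := h.choose_spec
    have : h.choose = a := by
      by_contra hne
      exact Set.disjoint_left.1 (hFd hch.1 ha hne) hch.2 hx
    simp only [hw]
    rw [dif_pos h, this]
  have hw0 : ∀ x, (¬ ∃ a ∈ F, x ∈ cpy a '' T) → w x = 0 := by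
    intro x hx
    simp only [hw]
    rw [dif_neg hx]
  have hnorm : ∀ x y, (∀ a ∈ F, x ∈ cpy a '' T → y ∉ cpy a '' T) → ‖w x‖ ≤ KV * dist x y := by
    intro x y h
    by_cases hx : ∃ a ∈ F, x ∈ cpy a '' T
    · obtain ⟨a, ha, hxa⟩ := hx
      have := hVaL a ha x y
      rw [hVa0 a ha y (h a ha hxa), dist_zero_right] at this
      rwa [hw1 a ha x hxa]
    · rw [hw0 x hx, norm_zero]; positivity
  have hwL : LipschitzWith (2 * KV) w := by
    refine LipschitzWith.of_dist_le_mul fun x y => ?_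
    push_cast
    by_cases hxy : ∃ a ∈ F, x ∈ cpy a '' T ∧ y ∈ cpy a '' T
    · obtain ⟨a, ha, hxa, hya⟩ := hxy
      rw [hw1 a ha x hxa, hw1 a ha y hya]
      have h1 := hVaL a ha x y
      have h2 : 0 ≤ KV * dist x y := by positivity
      linarith
    · have h1 := hnorm x y (fun a ha hx hy => hxy ⟨a, ha, hx, hy⟩)
      have h2 := hnorm y x (fun a ha hy hx => hxy ⟨a, ha, hx, hy⟩)
      rw [dist_comm y x] at h2
      have h3 : dist (w x) (w y) ≤ ‖w x‖ + ‖w y‖ := by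
        rw [dist_eq_norm]; exact norm_sub_le _ _
      linarith
  set u : Euc2 → Euc2 := fun x => matCLM M x + w x with hu
  have huL : LipschitzWith (‖matCLM M‖₊ + 2 * KV) u := (matCLM M).lipschitz.add hwL
  have hgrad : ∀ a ∈ F, ∀ z, z ∈ interior T → DifferentiableAt ℝ V z →
      grad2 u (cpy a z) = M + grad2 V z := by
    intro a ha z hz hd
    have hp := hFpos a ha
    have hev : u =ᶠ[nhds (cpy a z)] fun x => matCLM M x + Va a x := by
      have hop : IsOpen (cpyInv a ⁻¹' interior T) := isOpen_interior.preimage (cpyInv_cont a)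
      have hmem : cpy a z ∈ cpyInv a ⁻¹' interior T := by
        rwa [mem_preimage, cpyInv_cpy hp]
      filter_upwards [hop.mem_nhds hmem] with x hx
      simp only [hu]
      rw [hw1 a ha x]
      rw [cpy_image hp]
      show cpyInv a x ∈ T
      exact interior_subset (s := T) hx
    have hd1 : HasFDerivAt (cpyInv a) (a.2⁻¹ • ContinuousLinearMap.id ℝ Euc2) (cpy a z) := by
      unfold cpyInv
      exact ((hasFDerivAt_id _).sub_const _).fun_const_smul _
    have hd2 : HasFDerivAt V (fderiv ℝ V z) (cpyInv a (cpy a z)) := by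
      rw [cpyInv_cpy hp]; exact hd.hasFDerivAt
    have hd3 : HasFDerivAt (Va a) (fderiv ℝ V z) (cpy a z) := by
      have := (hd2.comp (cpy a z) hd1).const_smul a.2
      refine this.congr_fderiv ?_
      ext v k
      simp [hp.ne']
    have hd4 := ((matCLM M).hasFDerivAt.add hd3).congr_of_eventuallyEq hev
    rw [grad2_of_hasFDerivAt hd4]
    ext k j
    simp [matCLM_single, grad2]
  -- transfer of the good set
  have hgoodF : ∀ᵐ x ∂(volume : Measure Euc2), ∀ a ∈ F, x ∈ cpy a '' T →
      ((x ∈ cpy a '' D → symPart (grad2 u x) = E) ∧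
       (x ∉ cpy a '' D → symPart (grad2 u x) ∈ S)) := by
    rw [ae_ball_iff hFc]
    intro a ha
    have hp := hFpos a ha
    rw [ae_iff] at hgood ⊢
    have hz : volume (cpy a '' {z | ¬ (z ∈ T → z ∈ interior T ∧ DifferentiableAt ℝ V z ∧
      (z ∈ D → symPart (M + grad2 V z) = E) ∧ (z ∉ D → symPart (M + grad2 V z) ∈ S))}) = 0 := by
      rw [cpy_volume hp, hgood, mul_zero]
    refine measure_mono_null ?_ hz
    intro x hx
    simp only [mem_ofPred_eq] at hx
    refine ⟨cpyInv a x, ?_, cpy_cpyInv hp x⟩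
    simp only [mem_ofPred_eq]
    intro hg
    apply hx
    intro hxT
    rw [cpy_image hp] at hxT
    obtain ⟨h1, h2, h3, h4⟩ := hg hxT
    have hgr := hgrad a ha _ h1 h2
    rw [cpy_cpyInv hp] at hgr
    rw [cpy_image hp, hgr]
    exact ⟨h3, h4⟩
  have hcovae : ∀ᵐ x ∂(volume : Measure Euc2), x ∈ unitSq → ∃ a ∈ F, x ∈ cpy a '' T := by
    rw [ae_iff]
    refine measure_mono_null ?_ hFcov
    intro x hx
    simp only [mem_ofPred_eq, Classical.not_imp] at hx
    refine ⟨hx.1, ?_⟩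
    simpa using hx.2
  have hUae : volume unitSq = ∑' a : F, volume (cpy a '' T) := by
    rw [← measure_biUnion hFc hFd]
    · apply measure_congr
      filter_upwards [hcovae] with x hx
      apply propext
      constructor
      · intro h
        obtain ⟨a, ha, hxa⟩ := hx h
        exact mem_biUnion ha hxa
      · intro h
        obtain ⟨a, ha, hxa⟩ := mem_iUnion₂.1 h
        exact hFsq a ha hxa
    · intro a ha
      rw [cpy_image (hFpos a ha)]
      exact (hTc.preimage (cpyInv_cont a)).measurableSet
  have hFdD : F.PairwiseDisjoint (fun a => cpy a '' D) := by
    intro a ha b hb hab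
    exact (hFd ha hb hab).mono (image_mono hDT) (image_mono hDT)
  have hDae : volume {x ∈ unitSq | symPart (grad2 u x) = E} = ∑' a : F, volume (cpy a '' D) := by
    rw [← measure_biUnion hFc hFdD]
    · apply measure_congr
      filter_upwards [hcovae, hgoodF] with x hx hg
      apply propext
      constructor
      · rintro ⟨h, hE⟩
        obtain ⟨a, ha, hxa⟩ := hx h
        by_cases hxD : x ∈ cpy a '' D
        · exact mem_biUnion ha hxD
        · exact absurd (hE ▸ (hg a ha hxa).2 hxD) hES
      · intro h
        obtain ⟨a, ha, hxa⟩ := mem_iUnion₂.1 h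
        have hxT := image_mono hDT hxa
        exact ⟨hFsq a ha hxT, (hg a ha hxT).1 hxa⟩
    · intro a ha
      rw [cpy_image (hFpos a ha)]
      exact (cpyInv_cont a).measurable hD
  refine ⟨unitSq, u, _, unitSq_rect, huL, ?_, ?_, ?_⟩
  · filter_upwards [hcovae, hgoodF] with x hx hg hxs
    obtain ⟨a, ha, hxa⟩ := hx hxs
    by_cases hxD : x ∈ cpy a '' D
    · exact Or.inl ((hg a ha hxa).1 hxD)
    · exact Or.inr ((hg a ha hxa).2 hxD)
  · rw [hDae, hUae, div_eq_mul_inv, ← ENNReal.tsum_mul_right]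
    congr 1
    ext a
    rw [cpy_volume (hFpos a a.2), cpy_volume (hFpos a a.2), hvol, div_eq_mul_inv, mul_assoc]
  · intro x hx
    simp only [hu]
    rw [hw0 x, add_zero, matCLM_apply]
    rintro ⟨a, ha, hxa⟩
    exact hx (hFsq a ha hxa)

lemma open_and2 {X : Type*} [TopologicalSpace X] {f g h k : X → ℝ} (hf : Continuous f)
    (hg : Continuous g) (hh : Continuous h) (hk : Continuous k) :
    IsOpen {x | f x < g x ∧ h x < k x} :=
  (isOpen_lt hf hg).inter (isOpen_lt hh hk)

/-- Profile of the first component. -/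
def G1 (a b : ℝ) : ℝ := max 0 (min b (min (64/161 * (1 - b - a)) (4/11 * (1 - b))))

/-- Profile of the second component. -/
def G2 (a b : ℝ) : ℝ := max 0 (min (64/15 * a) (min (64/161 * (1 - b - a)) (64/225 * (1 - a))))

/-- First component of the base map. -/
def v1 (p : ℝ × ℝ) : ℝ := G1 |p.1| p.2 - G1 |p.1| (-p.2)

/-- Second component of the base map. -/
def v2 (p : ℝ × ℝ) : ℝ := -(G2 p.1 |p.2| - G2 (-p.1) |p.2|)

lemma lip_v1 : ∃ L, LipschitzWith L v1 := by
  have hx : LipschitzWith 1 (fun p : ℝ × ℝ => |p.1|) := by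
    have h := lipschitzWith_one_norm.comp (LipschitzWith.prod_fst (α := ℝ) (β := ℝ))
    rw [mul_one] at h
    exact h
  have hy : LipschitzWith 1 (fun p : ℝ × ℝ => p.2) := LipschitzWith.prod_snd
  have key : ∀ g : ℝ × ℝ → ℝ, LipschitzWith 1 g →
      ∃ L, LipschitzWith L (fun p : ℝ × ℝ => G1 |p.1| (g p)) := by
    intro g hg
    have h1 := (((LipschitzWith.const (α := ℝ × ℝ) (1:ℝ)).sub hg).sub hx)
    have h2 := ((LipschitzWith.const (α := ℝ × ℝ) (1:ℝ)).sub hg)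
    have h3 := (lipschitzWith_smul (64/161 : ℝ)).comp h1
    have h4 := (lipschitzWith_smul (4/11 : ℝ)).comp h2
    exact ⟨_, (LipschitzWith.const (α := ℝ × ℝ) (0:ℝ)).max (hg.min (h3.min h4))⟩
  obtain ⟨L1, h1⟩ := key _ hy
  obtain ⟨L2, h2⟩ := key _ hy.neg
  exact ⟨_, h1.sub h2⟩

lemma lip_v2 : ∃ L, LipschitzWith L v2 := by
  have hx : LipschitzWith 1 (fun p : ℝ × ℝ => |p.2|) := by
    have h := lipschitzWith_one_norm.comp (LipschitzWith.prod_snd (α := ℝ) (β := ℝ))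
    rw [mul_one] at h
    exact h
  have hy : LipschitzWith 1 (fun p : ℝ × ℝ => p.1) := LipschitzWith.prod_fst
  have key : ∀ g : ℝ × ℝ → ℝ, LipschitzWith 1 g →
      ∃ L, LipschitzWith L (fun p : ℝ × ℝ => G2 (g p) |p.2|) := by
    intro g hg
    have h1 := (((LipschitzWith.const (α := ℝ × ℝ) (1:ℝ)).sub hx).sub hg)
    have h2 := ((LipschitzWith.const (α := ℝ × ℝ) (1:ℝ)).sub hg)
    have h3 := (lipschitzWith_smul (64/161 : ℝ)).comp h1
    have h4 := (lipschitzWith_smul (64/225 : ℝ)).comp h2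
    have h5 := (lipschitzWith_smul (64/15 : ℝ)).comp hg
    exact ⟨_, (LipschitzWith.const (α := ℝ × ℝ) (0:ℝ)).max (h5.min (h3.min h4))⟩
  obtain ⟨L1, h1⟩ := key _ hy
  obtain ⟨L2, h2⟩ := key _ hy.neg
  exact ⟨_, (h1.sub h2).neg⟩

lemma G1_nonpos {a b : ℝ} (hb : b ≤ 0) : G1 a b = 0 :=
  max_eq_left ((min_le_left _ _).trans hb)

lemma G2_nonpos {a b : ℝ} (ha : a ≤ 0) : G2 a b = 0 :=
  max_eq_left ((min_le_left _ _).trans (by linarith))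

lemma G1_out {a b : ℝ} (h : 1 ≤ a + b) : G1 a b = 0 :=
  max_eq_left ((min_le_right _ _).trans ((min_le_left _ _).trans (by linarith)))

lemma G2_out {a b : ℝ} (h : 1 ≤ a + b) : G2 a b = 0 :=
  max_eq_left ((min_le_right _ _).trans ((min_le_left _ _).trans (by linarith)))

lemma v1_sign {s1 s2 : ℝ} (h1 : s1 = 1 ∨ s1 = -1) (h2 : s2 = 1 ∨ s2 = -1) {p : ℝ × ℝ}
    (hx : 0 ≤ s1 * p.1) (hy : 0 ≤ s2 * p.2) : v1 p = s2 * G1 (s1 * p.1) (s2 * p.2) := by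
  have ha : |p.1| = s1 * p.1 := by
    rcases h1 with rfl | rfl
    · rw [abs_of_nonneg (by linarith)]; ring
    · rw [abs_of_nonpos (by linarith)]; ring
  unfold v1
  rw [ha]
  rcases h2 with rfl | rfl
  · rw [G1_nonpos (b := -p.2) (by linarith)]; simp
  · rw [G1_nonpos (b := p.2) (by linarith)]; simp

lemma v2_sign {s1 s2 : ℝ} (h1 : s1 = 1 ∨ s1 = -1) (h2 : s2 = 1 ∨ s2 = -1) {p : ℝ × ℝ}
    (hx : 0 ≤ s1 * p.1) (hy : 0 ≤ s2 * p.2) : v2 p = -s1 * G2 (s1 * p.1) (s2 * p.2) := by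
  have ha : |p.2| = s2 * p.2 := by
    rcases h2 with rfl | rfl
    · rw [abs_of_nonneg (by linarith)]; ring
    · rw [abs_of_nonpos (by linarith)]; ring
  unfold v2
  rw [ha]
  rcases h1 with rfl | rfl
  · rw [G2_nonpos (a := -p.1) (by linarith)]; simp
  · rw [G2_nonpos (a := p.1) (by linarith)]; simp

/-- The sign data of a point. -/
lemma exists_sign (x : ℝ) (hx : x ≠ 0) : ∃ s : ℝ, (s = 1 ∨ s = -1) ∧ 0 < s * x ∧ |x| = s * x := by
  rcases lt_or_gt_of_ne hx with h | h
  · exact ⟨-1, Or.inr rfl, by linarith, by rw [abs_of_neg h]; ring⟩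
  · exact ⟨1, Or.inl rfl, by linarith, by rw [abs_of_pos h]; ring⟩

lemma exists_sign' (x : ℝ) : ∃ s : ℝ, (s = 1 ∨ s = -1) ∧ 0 ≤ s * x ∧ |x| = s * x := by
  rcases lt_or_ge x 0 with h | h
  · exact ⟨-1, Or.inr rfl, by linarith, by rw [abs_of_neg h]; ring⟩
  · exact ⟨1, Or.inl rfl, by linarith, by rw [abs_of_nonneg h]; ring⟩

/-- The support diamond. -/
def T0 : Set (ℝ × ℝ) := {p | |p.1| + |p.2| ≤ 1}

/-- The region where the strain is the well. -/
def D0 : Set (ℝ × ℝ) := {p | 1/16 < |p.1| ∧ |p.2| < 64/225 * (1 - |p.1|)}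

lemma v1_out {p : ℝ × ℝ} (h : p ∉ T0) : v1 p = 0 := by
  have h' : 1 ≤ |p.1| + |p.2| := by
    have : ¬ (|p.1| + |p.2| ≤ 1) := h
    linarith
  obtain ⟨s1, h1, hx, e1⟩ := exists_sign' p.1
  obtain ⟨s2, h2, hy, e2⟩ := exists_sign' p.2
  rw [v1_sign h1 h2 hx hy, G1_out (by linarith), mul_zero]

lemma v2_out {p : ℝ × ℝ} (h : p ∉ T0) : v2 p = 0 := by
  have h' : 1 ≤ |p.1| + |p.2| := by
    have : ¬ (|p.1| + |p.2| ≤ 1) := h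
    linarith
  obtain ⟨s1, h1, hx, e1⟩ := exists_sign' p.1
  obtain ⟨s2, h2, hy, e2⟩ := exists_sign' p.2
  rw [v2_sign h1 h2 hx hy, G2_out (by linarith), mul_zero]

lemma max_min3 {x y z v : ℝ} (h0 : 0 ≤ v) (h : (x = v ∧ v ≤ y ∧ v ≤ z) ∨ (y = v ∧ v ≤ x ∧ v ≤ z) ∨
    (z = v ∧ v ≤ x ∧ v ≤ y)) : max 0 (min x (min y z)) = v := by
  have : min x (min y z) = v := by
    apply le_antisymm
    · rcases h with ⟨h, -, -⟩ | ⟨h, -, -⟩ | ⟨h, -, -⟩ <;> simp [h]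
    · refine le_min ?_ (le_min ?_ ?_) <;>
        rcases h with ⟨h, h', h''⟩ | ⟨h, h', h''⟩ | ⟨h, h', h''⟩ <;> linarith
  rw [this, max_eq_right h0]

lemma reg_D {a b : ℝ} (ha : 1/16 < a) (hb : 0 < b) (h : b < 64/225 * (1 - a)) :
    G1 a b = b ∧ G2 a b = 64/225 * (1 - a) := by
  constructor
  · exact max_min3 hb.le (Or.inl ⟨rfl, by linarith, by linarith⟩)
  · exact max_min3 (by linarith) (Or.inr (Or.inr ⟨rfl, by linarith, by linarith⟩))

lemma reg_X {a b : ℝ} (ha : 0 < a) (ha' : a < 1/16) (hb : 0 < b) (h : b < 4/15) :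
    G1 a b = b ∧ G2 a b = 64/15 * a := by
  constructor
  · exact max_min3 hb.le (Or.inl ⟨rfl, by linarith, by linarith⟩)
  · exact max_min3 (by linarith) (Or.inl ⟨rfl, by linarith, by linarith⟩)

lemma reg_W {a b : ℝ} (ha : 0 < a) (hb : 4/15 < b) (h : 64/15 * a < 64/161 * (1 - b - a)) :
    G1 a b = 4/11 * (1 - b) ∧ G2 a b = 64/15 * a := by
  constructor
  · exact max_min3 (by linarith) (Or.inr (Or.inr ⟨rfl, by linarith, by linarith⟩))
  · exact max_min3 (by linarith) (Or.inl ⟨rfl, by linarith, by linarith⟩)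

lemma reg_S {a b : ℝ} (ha : 0 < a) (hb : 64/225 * (1 - a) < b)
    (h : 64/161 * (1 - b - a) < 64/15 * a) (hab : a + b < 1) :
    G1 a b = 64/161 * (1 - b - a) ∧ G2 a b = 64/161 * (1 - b - a) := by
  constructor
  · exact max_min3 (by linarith) (Or.inr (Or.inl ⟨rfl, by linarith, by linarith⟩))
  · exact max_min3 (by linarith) (Or.inr (Or.inl ⟨rfl, by linarith, by linarith⟩))

/-- `v1, v2` are locally affine near `p` with the given slopes. -/
def LocAff (p : ℝ × ℝ) (a1 b1 a2 b2 : ℝ) : Prop :=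
  ∃ c1 c2 : ℝ, (∀ᶠ q in nhds p, v1 q = c1 + (a1 * q.1 + b1 * q.2)) ∧
    (∀ᶠ q in nhds p, v2 q = c2 + (a2 * q.1 + b2 * q.2))

/-- Generic reduction of local affinity to the positive quadrant. -/
lemma locAff_of_region {s1 s2 : ℝ} (h1 : s1 = 1 ∨ s1 = -1) (h2 : s2 = 1 ∨ s2 = -1) {p : ℝ × ℝ}
    (hx : 0 < s1 * p.1) (hy : 0 < s2 * p.2) (P : ℝ → ℝ → Prop)
    (hP : IsOpen {q : ℝ × ℝ | P (s1 * q.1) (s2 * q.2)}) (hp : P (s1 * p.1) (s2 * p.2))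
    (c a b c' a' b' : ℝ)
    (hG : ∀ x y, 0 < x → 0 < y → P x y →
      G1 x y = c + (a * x + b * y) ∧ G2 x y = c' + (a' * x + b' * y)) :
    LocAff p (s1 * s2 * a) b (-a') (-(s1 * s2) * b') := by
  have hs1 : s1 * s1 = 1 := by rcases h1 with rfl | rfl <;> norm_num
  have hs2 : s2 * s2 = 1 := by rcases h2 with rfl | rfl <;> norm_num
  have hev : ∀ᶠ q : ℝ × ℝ in nhds p, 0 < s1 * q.1 ∧ 0 < s2 * q.2 ∧ P (s1 * q.1) (s2 * q.2) := by
    have o1 : IsOpen {q : ℝ × ℝ | 0 < s1 * q.1} := isOpen_lt continuous_const (by fun_prop)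
    have o2 : IsOpen {q : ℝ × ℝ | 0 < s2 * q.2} := isOpen_lt continuous_const (by fun_prop)
    filter_upwards [o1.mem_nhds hx, o2.mem_nhds hy, hP.mem_nhds hp] with q a b c
    exact ⟨a, b, c⟩
  refine ⟨s2 * c, -s1 * c', ?_, ?_⟩
  · filter_upwards [hev] with q hq
    rw [v1_sign h1 h2 hq.1.le hq.2.1.le, (hG _ _ hq.1 hq.2.1 hq.2.2).1]
    linear_combination (b * q.2) * hs2
  · filter_upwards [hev] with q hq
    rw [v2_sign h1 h2 hq.1.le hq.2.1.le, (hG _ _ hq.1 hq.2.1 hq.2.2).2]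
    linear_combination (-a' * q.1) * hs1

lemma line_null (α β c : ℝ) (h : α ≠ 0 ∨ β ≠ 0) :
    ∀ᵐ p ∂(volume : Measure (ℝ × ℝ)), α * p.1 + β * p.2 ≠ c := by
  by_cases hβ : β = 0
  · have hα : α ≠ 0 := by tauto
    rw [ae_iff]
    have : {p : ℝ × ℝ | ¬ (α * p.1 + β * p.2 ≠ c)} = {c / α} ×ˢ univ := by
      ext p
      simp only [hβ, mem_ofPred_eq, not_not, mem_prod, mem_singleton_iff, mem_univ, and_true]
      rw [eq_div_iff hα]
      constructor <;> intro h <;> linarith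
    rw [this, Measure.volume_eq_prod, Measure.prod_prod]
    simp
  · rw [ae_iff]
    have hm : MeasurableSet {p : ℝ × ℝ | ¬ (α * p.1 + β * p.2 ≠ c)} := by
      simp only [not_not]
      exact (isClosed_eq (by fun_prop) (by fun_prop)).measurableSet
    rw [Measure.volume_eq_prod, Measure.measure_prod_null hm]
    refine Filter.Eventually.of_forall fun x => ?_
    refine measure_mono_null (t := {(c - α * x) / β}) ?_ (by simp)
    intro y hy
    simp only [mem_preimage, mem_ofPred_eq, not_not] at hy
    rw [mem_singleton_iff, eq_div_iff hβ]
    linarith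

lemma abs_line_null (α β c : ℝ) (h : α ≠ 0 ∨ β ≠ 0) :
    ∀ᵐ p ∂(volume : Measure (ℝ × ℝ)), α * |p.1| + β * |p.2| ≠ c := by
  have h' : ∀ s1 s2 : ℝ, (s1 = 1 ∨ s1 = -1) → (s2 = 1 ∨ s2 = -1) →
      α * s1 ≠ 0 ∨ β * s2 ≠ 0 := by
    rintro s1 s2 (rfl | rfl) (rfl | rfl) <;> simpa using h
  filter_upwards [line_null _ _ c (h' 1 1 (by simp) (by simp)),
    line_null _ _ c (h' 1 (-1) (by simp) (by simp)),
    line_null _ _ c (h' (-1) 1 (by simp) (by simp)),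
    line_null _ _ c (h' (-1) (-1) (by simp) (by simp))] with p q1 q2 q3 q4
  rcases abs_cases p.1 with ⟨e, -⟩ | ⟨e, -⟩ <;> rcases abs_cases p.2 with ⟨f, -⟩ | ⟨f, -⟩ <;>
    rw [e, f]
  · intro h; exact q1 (by linarith)
  · intro h; exact q2 (by linarith)
  · intro h; exact q3 (by linarith)
  · intro h; exact q4 (by linarith)

lemma base_ae : ∀ᵐ p ∂(volume : Measure (ℝ × ℝ)), p ∈ T0 → |p.1| + |p.2| < 1 ∧
    (p ∈ D0 → LocAff p 0 1 (64/225) 0) ∧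
    (p ∉ D0 → LocAff p (-64/161) (-64/161) (64/161) (64/161) ∨
      LocAff p (64/161) (-64/161) (64/161) (-64/161) ∨
      LocAff p 0 1 (-64/15) 0 ∨ LocAff p 0 (-4/11) (-64/15) 0) := by
  filter_upwards [abs_line_null 1 0 0 (by norm_num), abs_line_null 0 1 0 (by norm_num),
    abs_line_null 1 0 (1/16) (by norm_num), abs_line_null 0 1 (4/15) (by norm_num),
    abs_line_null (64/225) 1 (64/225) (by norm_num),
    abs_line_null (64/15 + 64/161) (64/161) (64/161) (by norm_num),
    abs_line_null 1 1 1 (by norm_num)] with p n1 n2 n3 n4 n5 n6 n7 hT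
  have hT' : |p.1| + |p.2| ≤ 1 := hT
  have hlt : |p.1| + |p.2| < 1 := lt_of_le_of_ne hT' (by intro h; exact n7 (by linarith))
  have hx0 : p.1 ≠ 0 := by intro h; apply n1; rw [h]; simp
  have hy0 : p.2 ≠ 0 := by intro h; apply n2; rw [h]; simp
  obtain ⟨s1, h1, hx, e1⟩ := exists_sign p.1 hx0
  obtain ⟨s2, h2, hy, e2⟩ := exists_sign p.2 hy0
  refine ⟨hlt, ?_, ?_⟩
  · rintro ⟨hd1, hd2⟩
    rw [e1] at hd1 hd2
    rw [e2] at hd2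
    have := locAff_of_region h1 h2 hx hy (fun a b => 1/16 < a ∧ b < 64/225 * (1 - a))
      (open_and2 (by fun_prop) (by fun_prop) (by fun_prop) (by fun_prop))
      ⟨hd1, hd2⟩ 0 0 1 (64/225) (-64/225) 0
      (fun x y _ hy' hP => by
        obtain ⟨g1, g2⟩ := reg_D hP.1 hy' hP.2
        rw [g1, g2]; constructor <;> ring)
    convert this using 1 <;> ring
  · intro hnD
    have hnD' : ¬ (1/16 < |p.1| ∧ |p.2| < 64/225 * (1 - |p.1|)) := hnD
    rw [e1, e2] at hnD' n5 n6 hlt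
    rw [e1] at n3
    rw [e2] at n4
    set a := s1 * p.1 with ha
    set b := s2 * p.2 with hb
    by_cases c1 : a < 1/16 ∧ b < 4/15
    · right; right; left
      have := locAff_of_region h1 h2 hx hy (fun a b => a < 1/16 ∧ b < 4/15)
        (open_and2 (by fun_prop) (by fun_prop) (by fun_prop) (by fun_prop))
        c1 0 0 1 0 (64/15) 0
        (fun x y hx' hy' hP => by
          obtain ⟨g1, g2⟩ := reg_X hx' hP.1 hy' hP.2
          rw [g1, g2]; constructor <;> ring)
      convert this using 1 <;> ring
    · by_cases c2 : 4/15 < b ∧ 64/15 * a < 64/161 * (1 - b - a)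
      · right; right; right
        have := locAff_of_region h1 h2 hx hy
          (fun a b => 4/15 < b ∧ 64/15 * a < 64/161 * (1 - b - a))
          (open_and2 (by fun_prop) (by fun_prop) (by fun_prop) (by fun_prop))
          c2 (4/11) 0 (-4/11) 0 (64/15) 0
          (fun x y hx' hy' hP => by
            obtain ⟨g1, g2⟩ := reg_W hx' hP.1 hP.2
            rw [g1, g2]; constructor <;> ring)
        convert this using 1 <;> ring
      · have c3 : (64/225 * (1 - a) < b ∧ 64/161 * (1 - b - a) < 64/15 * a) ∧ a + b < 1 := by
          have n3' : a ≠ 1/16 := fun h => n3 (by linarith)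
          have n4' : b ≠ 4/15 := fun h => n4 (by linarith)
          have n5' : b ≠ 64/225 * (1 - a) := fun h => n5 (by linarith)
          have n6' : 64/161 * (1 - b - a) ≠ 64/15 * a := fun h => n6 (by linarith)
          rcases lt_or_gt_of_ne n3' with q3 | q3 <;> rcases lt_or_gt_of_ne n4' with q4 | q4 <;>
          rcases lt_or_gt_of_ne n5' with q5 | q5 <;> rcases lt_or_gt_of_ne n6' with q6 | q6 <;>
          first
          | exact (c1 (And.intro q3 q4)).elim
          | exact (c2 (And.intro q4 q6)).elim
          | exact (hnD' (And.intro q3 q5)).elim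
          | exact ⟨⟨q5, q6⟩, hlt⟩
          | (exfalso; linarith)
        have := locAff_of_region h1 h2 hx hy
          (fun a b => (64/225 * (1 - a) < b ∧ 64/161 * (1 - b - a) < 64/15 * a) ∧ a + b < 1)
          ((open_and2 (by fun_prop) (by fun_prop) (by fun_prop) (by fun_prop)).inter
            (isOpen_lt (f := fun q : ℝ × ℝ => s1 * q.1 + s2 * q.2) (by fun_prop) continuous_const))
          c3 (64/161) (-64/161) (-64/161) (64/161) (-64/161) (-64/161)
          (fun x y hx' hy' hP => by
            obtain ⟨g1, g2⟩ := reg_S hx' hP.1.1 hP.1.2 hP.2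
            rw [g1, g2]; constructor <;> ring)
        have hss : s1 * s2 = 1 ∨ s1 * s2 = -1 := by
          rcases h1 with rfl | rfl <;> rcases h2 with rfl | rfl <;> norm_num
        rcases hss with e | e <;> rw [e] at this
        · left; convert this using 1 <;> ring
        · right; left; convert this using 1 <;> ring

lemma area_gen (w s : ℝ) (hw : 0 ≤ w) (hw1 : w ≤ 1) (hs : 0 < s) :
    volume {p : ℝ × ℝ | w < |p.1| ∧ |p.2| < s * (1 - |p.1|)} =
      ENNReal.ofReal (2 * s * (1 - w) ^ 2) := by
  set S : Set ℝ := {x | w < |x| ∧ |x| < 1} with hS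
  have hSm : MeasurableSet S :=
    (open_and2 (by fun_prop) (by fun_prop) (by fun_prop) (by fun_prop)).measurableSet
  have hSf : S ⊆ Icc (-1) 1 := fun x hx => ⟨(abs_lt.1 hx.2).1.le, (abs_lt.1 hx.2).2.le⟩
  have heq : {p : ℝ × ℝ | w < |p.1| ∧ |p.2| < s * (1 - |p.1|)} =
      regionBetween (fun x => -(s * (1 - |x|))) (fun x => s * (1 - |x|)) S := by
    ext p
    constructor
    · rintro ⟨h1, h2⟩
      have : 0 < 1 - |p.1| := by
        have := (abs_nonneg _).trans_lt h2
        exact (mul_pos_iff_of_pos_left hs).1 this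
      exact ⟨⟨h1, by linarith⟩, abs_lt.1 h2⟩
    · rintro ⟨⟨h1, -⟩, h2⟩
      exact ⟨h1, abs_lt.2 h2⟩
  have hint : ∀ f : ℝ → ℝ, Continuous f → IntegrableOn f S volume := fun f hf =>
    (hf.continuousOn.integrableOn_compact isCompact_Icc).mono_set hSf
  rw [heq, Measure.volume_eq_prod, volume_regionBetween_eq_integral (hint _ (by fun_prop))
    (hint _ (by fun_prop)) hSm]
  · congr 1
    have hf : ∀ x, S.indicator (fun y => ((fun x => s * (1 - |x|)) - fun x => -(s * (1 - |x|))) y) x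
        = (fun r => (Ioo w 1).indicator (fun r => 2 * s * (1 - r)) r) |x| := by
      intro x
      simp only [indicator, hS, mem_ofPred_eq, mem_Ioo, Pi.sub_apply]
      split_ifs <;> ring
    rw [← integral_indicator hSm]
    simp_rw [hf]
    rw [integral_comp_abs, setIntegral_indicator measurableSet_Ioo]
    have : Ioi (0:ℝ) ∩ Ioo w 1 = Ioo w 1 := by
      apply inter_eq_right.2
      intro x hx
      exact hw.trans_lt hx.1
    rw [this, ← integral_Ioc_eq_integral_Ioo, ← intervalIntegral.integral_of_le hw1]
    have : ∫ x in w..1, 2 * s * (1 - x) = s * (1 - w) ^ 2 := by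
      have hd : ∀ x ∈ uIcc w 1, HasDerivAt (fun x => -(s * (1 - x) ^ 2)) (2 * s * (1 - x)) x := by
        intro x _
        have := ((((hasDerivAt_id x).const_sub 1).pow 2).const_mul s).neg
        refine this.congr_deriv ?_
        simp; ring
      rw [intervalIntegral.integral_eq_sub_of_hasDerivAt hd
        (Continuous.intervalIntegrable (by fun_prop) _ _)]
      ring
    rw [this]; ring
  · intro x hx
    have : 0 ≤ s * (1 - |x|) := mul_nonneg hs.le (by linarith [hx.2])
    show -(s * (1 - |x|)) ≤ s * (1 - |x|)
    linarith

lemma area_D0 : volume D0 = ENNReal.ofReal (1/2) := by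
  have := area_gen (1/16) (64/225) (by norm_num) (by norm_num) (by norm_num)
  unfold D0
  rw [this]; norm_num

lemma area_T0 : volume T0 = ENNReal.ofReal 2 := by
  have := area_gen 0 1 (by norm_num) (by norm_num) (by norm_num)
  have h2 : volume T0 = volume {p : ℝ × ℝ | 0 < |p.1| ∧ |p.2| < 1 * (1 - |p.1|)} := by
    apply measure_congr
    filter_upwards [abs_line_null 1 0 0 (by norm_num), abs_line_null 1 1 1 (by norm_num)]
      with p n1 n2
    apply propext
    constructor
    · intro h
      have h' : |p.1| + |p.2| ≤ 1 := h
      refine ⟨lt_of_le_of_ne (abs_nonneg _) fun h => n1 (by linarith), ?_⟩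
      exact lt_of_le_of_ne (by linarith) fun h => n2 (by linarith)
    · rintro ⟨h1, h2⟩
      show |p.1| + |p.2| ≤ 1
      linarith
  rw [h2, this]; norm_num

lemma area_rel : volume D0 = volume T0 / 4 := by
  rw [area_D0, area_T0, show (4:ENNReal) = ENNReal.ofReal 4 by norm_num,
    ← ENNReal.ofReal_div_of_pos (by norm_num)]
  norm_num

lemma D0_sub : D0 ⊆ T0 := by
  rintro p ⟨h1, h2⟩
  show |p.1| + |p.2| ≤ 1
  have := abs_nonneg p.2
  linarith

lemma T0_closed : IsClosed T0 := isClosed_le (by fun_prop) (by fun_prop)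

lemma D0_meas : MeasurableSet D0 :=
  (open_and2 (by fun_prop) (by fun_prop) (by fun_prop) (by fun_prop)).measurableSet

/-- The rotated and stretched coordinates. -/
def phi (c s d : ℝ) (hcs : c ^ 2 + s ^ 2 = 1) (hd : d ≠ 0) : Euc2 ≃L[ℝ] ℝ × ℝ :=
  LinearEquiv.toContinuousLinearEquiv
    { toFun := fun p => (d * (c * p 0 + s * p 1), -s * p 0 + c * p 1)
      invFun := fun q => !₂[c * (q.1 / d) - s * q.2, s * (q.1 / d) + c * q.2]
      map_add' := by
        intro x y
        ext <;> simp <;> ring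
      map_smul' := by
        intro r x
        ext <;> simp <;> ring
      left_inv := by
        intro p
        ext k
        fin_cases k
        · simp [hd]; linear_combination (p 0) * hcs
        · simp [hd]; linear_combination (p 1) * hcs
      right_inv := by
        intro q
        ext
        · simp; field_simp; linear_combination (q.1) * hcs
        · simp; field_simp; linear_combination (d * q.2) * hcs }

lemma phi_fst (c s d : ℝ) (hcs : c ^ 2 + s ^ 2 = 1) (hd : d ≠ 0) (p : Euc2) :
    (phi c s d hcs hd p).1 = d * (c * p 0 + s * p 1) := rfl

lemma phi_snd (c s d : ℝ) (hcs : c ^ 2 + s ^ 2 = 1) (hd : d ≠ 0) (p : Euc2) :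
    (phi c s d hcs hd p).2 = -s * p 0 + c * p 1 := rfl

/-- The base displacement. -/
def VV (F : Euc2 → ℝ × ℝ) (P R : Euc2) (p : Euc2) : Euc2 := v1 (F p) • P + v2 (F p) • R

lemma VV_lip (F : Euc2 ≃L[ℝ] ℝ × ℝ) (P R : Euc2) : ∃ L, LipschitzWith L (VV F P R) := by
  obtain ⟨L1, h1⟩ := lip_v1
  obtain ⟨L2, h2⟩ := lip_v2
  have hF := (F : Euc2 →L[ℝ] ℝ × ℝ).lipschitz
  have k1 := (ContinuousLinearMap.toSpanSingleton ℝ P).lipschitz.comp (h1.comp hF)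
  have k2 := (ContinuousLinearMap.toSpanSingleton ℝ R).lipschitz.comp (h2.comp hF)
  exact ⟨_, k1.add k2⟩

lemma VV_grad (c s d A0 : ℝ) (hcs : c ^ 2 + s ^ 2 = 1) (hd : d ≠ 0) (p : Euc2)
    (a1 b1 a2 b2 : ℝ) (h : LocAff (phi c s d hcs hd p) a1 b1 a2 b2) :
    HasFDerivAt (VV (phi c s d hcs hd) !₂[A0 * c, A0 * s] !₂[-(A0 * d * s), A0 * d * c])
      (matCLM !![A0 * ((a1 * d * c - b1 * s) * c - d * (a2 * d * c - b2 * s) * s),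
                 A0 * ((a1 * d * s + b1 * c) * c - d * (a2 * d * s + b2 * c) * s);
                 A0 * ((a1 * d * c - b1 * s) * s + d * (a2 * d * c - b2 * s) * c),
                 A0 * ((a1 * d * s + b1 * c) * s + d * (a2 * d * s + b2 * c) * c)]) p := by
  obtain ⟨c1, c2, e1, e2⟩ := h
  set F := phi c s d hcs hd with hF
  have t : Filter.Tendsto F (nhds p) (nhds (F p)) := F.continuous.tendsto p
  have e1' := t.eventually e1
  have e2' := t.eventually e2
  have := (matCLM !![A0 * ((a1 * d * c - b1 * s) * c - d * (a2 * d * c - b2 * s) * s),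
                 A0 * ((a1 * d * s + b1 * c) * c - d * (a2 * d * s + b2 * c) * s);
                 A0 * ((a1 * d * c - b1 * s) * s + d * (a2 * d * c - b2 * s) * c),
                 A0 * ((a1 * d * s + b1 * c) * s + d * (a2 * d * s + b2 * c) * c)]).hasFDerivAt
                 (x := p)
  have := this.const_add (c1 • (!₂[A0 * c, A0 * s] : Euc2) +
    c2 • (!₂[-(A0 * d * s), A0 * d * c] : Euc2))
  refine this.congr_of_eventuallyEq ?_
  filter_upwards [e1', e2'] with q h1 h2
  have f1 : (F q).1 = d * (c * q 0 + s * q 1) := rfl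
  have f2 : (F q).2 = -s * q 0 + c * q 1 := rfl
  unfold VV
  rw [h1, h2, f1, f2, matCLM_apply]
  ext k
  fin_cases k
  · simp [matVec2, Fin.sum_univ_two]; ring
  · simp [matVec2, Fin.sum_univ_two]; ring

lemma polar (qa qb : ℝ) : ∃ ρ c s : ℝ, c ^ 2 + s ^ 2 = 1 ∧ qa = -(ρ * (2 * s * c)) ∧
    qb = ρ * (c ^ 2 - s ^ 2) := by
  set z : ℂ := ⟨qb, -qa⟩ with hz
  refine ⟨‖z‖, Real.cos (z.arg / 2), Real.sin (z.arg / 2), ?_, ?_, ?_⟩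
  · rw [add_comm]; exact Real.sin_sq_add_cos_sq _
  · have := Complex.norm_mul_sin_arg z
    rw [← Real.sin_two_mul, mul_div_cancel₀ _ (by norm_num : (2:ℝ) ≠ 0), this]
    simp [hz]
  · have := Complex.norm_mul_cos_arg z
    rw [← Real.cos_two_mul', mul_div_cancel₀ _ (by norm_num : (2:ℝ) ≠ 0), this]

/-- Barycentric criterion. -/
lemma inInt_of (A R : Matrix (Fin 2) (Fin 2) ℝ) (l r : Fin 3 → ℝ) (hs : ∑ k, l k = 1)
    (hA : A = ∑ k, l k • hexWells k) (hr : ∑ k, r k = 0) (hR : R = ∑ k, r k • hexWells k)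
    (i : Fin 3) (x y : ℝ)
    (hpos : ∀ k, 0 < l k + x * ((if k = i then 1 else 0) - l k) + y * r k) :
    inIntConv (A + x • (hexWells i - A) + y • R) := by
  refine ⟨fun k => l k + x * ((if k = i then 1 else 0) - l k) + y * r k, hpos, ?_, ?_⟩
  · rw [Finset.sum_add_distrib, Finset.sum_add_distrib, ← Finset.mul_sum, ← Finset.mul_sum,
      Finset.sum_sub_distrib, hs, hr]
    simp
  · simp only [add_smul, mul_smul, sub_smul, Finset.sum_add_distrib, ← Finset.smul_sum,
      Finset.sum_sub_distrib, ← hA, ← hR]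
    simp

lemma choose_delta (l r : Fin 3 → ℝ) (hl : ∀ k, 0 < l k) (hs : ∑ k, l k = 1) (i : Fin 3)
    (hi : 64/225 < l i) : ∃ d : ℝ, 0 < d ∧
    ∀ v : ℝ × ℝ × ℝ, v ∈ ({(-64/161, -64/161, 64/161), (64/161, -64/161, 64/161),
        (0, 1, -64/15), (0, -4/11, -64/15)} : Set (ℝ × ℝ × ℝ)) →
      ∀ k, 0 < l k + ((v.2.1 + d ^ 2 * v.2.2) / (1 + 64/225 * d ^ 2)) *
        ((if k = i then 1 else 0) - l k) + (v.1 * d / (1 + 64/225 * d ^ 2)) * r k := by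
  have hev : ∀ a1 b1 a2 : ℝ, (∀ k, 0 < l k + b1 * ((if k = i then 1 else 0) - l k)) →
      ∀ᶠ d : ℝ in nhds 0, ∀ k, 0 < l k + ((b1 + d ^ 2 * a2) / (1 + 64/225 * d ^ 2)) *
        ((if k = i then 1 else 0) - l k) + (a1 * d / (1 + 64/225 * d ^ 2)) * r k := by
    intro a1 b1 a2 h
    rw [Filter.eventually_all]
    intro k
    have hN : ∀ d : ℝ, 1 + 64/225 * d ^ 2 ≠ 0 := fun d => by positivity
    have hc : Continuous fun d : ℝ => l k + ((b1 + d ^ 2 * a2) / (1 + 64/225 * d ^ 2)) *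
        ((if k = i then 1 else 0) - l k) + (a1 * d / (1 + 64/225 * d ^ 2)) * r k := by
      have q1 : Continuous fun d : ℝ => (b1 + d ^ 2 * a2) / (1 + 64/225 * d ^ 2) :=
        Continuous.div (by fun_prop) (by fun_prop) hN
      have q2 : Continuous fun d : ℝ => a1 * d / (1 + 64/225 * d ^ 2) :=
        Continuous.div (by fun_prop) (by fun_prop) hN
      exact (continuous_const.add (q1.mul continuous_const)).add (q2.mul continuous_const)
    have ht := hc.tendsto 0
    refine ht.eventually (lt_mem_nhds ?_)
    have := h k
    simpa using this
  have hlt : ∀ k, l k < 1 := by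
    intro k
    rw [Fin.sum_univ_three] at hs
    have := hl 0; have := hl 1; have := hl 2
    fin_cases k <;> simp <;> linarith
  have hneg : ∀ b1 : ℝ, -64/161 ≤ b1 → b1 ≤ 0 →
      ∀ k, 0 < l k + b1 * ((if k = i then 1 else 0) - l k) := by
    intro b1 hb hb' k
    split_ifs with hk
    · subst hk
      have := hlt k
      nlinarith
    · have := hl k
      nlinarith
  have e1 := hev (-64/161) (-64/161) (64/161) (hneg _ (by norm_num) (by norm_num))
  have e2 := hev (64/161) (-64/161) (64/161) (hneg _ (by norm_num) (by norm_num))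
  have e4 := hev 0 (-4/11) (-64/15) (hneg _ (by norm_num) (by norm_num))
  have e3 : ∀ᶠ d : ℝ in nhds 0, 64/15 * d ^ 2 < 1 := by
    have hc : Continuous fun d : ℝ => 64/15 * d ^ 2 := by fun_prop
    exact (hc.tendsto 0).eventually (gt_mem_nhds (by norm_num))
  have e := (e1.and (e2.and (e3.and e4))).filter_mono (nhdsWithin_le_nhds (s := Ioi 0))
  obtain ⟨d, ⟨h1, h2, h3, h4⟩, hd⟩ := (e.and self_mem_nhdsWithin).exists
  have hd' : 0 < d := hd
  refine ⟨d, hd', ?_⟩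
  rintro v (rfl | rfl | rfl | rfl)
  · exact h1
  · exact h2
  · intro k
    have hN : 0 < 1 + 64/225 * d ^ 2 := by positivity
    set x := (1 + d ^ 2 * (-64/15)) / (1 + 64/225 * d ^ 2) with hx
    have hx0 : 0 ≤ x := div_nonneg (by linarith) hN.le
    have hx1 : x < 1 := by
      rw [hx, div_lt_one hN]
      have : 0 < d ^ 2 := by positivity
      linarith
    have := hl k
    simp only [zero_mul, zero_div, add_zero]
    split_ifs <;> nlinarith
  · exact h4

lemma strain_eq (M G A Q R : Matrix (Fin 2) (Fin 2) ℝ) (ρ c s d a1 b1 a2 A0 N : ℝ)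
    (hA : A = symPart M) (hN : N ≠ 0) (hA0 : A0 = 2 * ρ / N)
    (hQ : Q = !![-(ρ * (2 * s * c)), ρ * (c ^ 2 - s ^ 2); ρ * (c ^ 2 - s ^ 2), ρ * (2 * s * c)])
    (hR : R = !![2 * ρ * (c ^ 2 - s ^ 2), 2 * ρ * (2 * s * c);
      2 * ρ * (2 * s * c), -(2 * ρ * (c ^ 2 - s ^ 2))])
    (hG : G = !![A0 * ((a1 * d * c - b1 * s) * c - d * (a2 * d * c - -a1 * s) * s),
                 A0 * ((a1 * d * s + b1 * c) * c - d * (a2 * d * s + -a1 * c) * s);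
                 A0 * ((a1 * d * c - b1 * s) * s + d * (a2 * d * c - -a1 * s) * c),
                 A0 * ((a1 * d * s + b1 * c) * s + d * (a2 * d * s + -a1 * c) * c)]) :
    symPart (M + G) = A + ((b1 + d ^ 2 * a2) / N) • Q + (a1 * d / N) • R := by
  subst hA hQ hR hG hA0
  unfold symPart
  ext i j
  fin_cases i <;> fin_cases j <;>
    simp [Matrix.add_apply, Matrix.transpose_apply] <;> field_simp <;> ring

lemma measure_transfer (F : Euc2 ≃L[ℝ] ℝ × ℝ) : ∃ κ : ENNReal,
    Measure.map F (volume : Measure Euc2) = κ • (volume : Measure (ℝ × ℝ)) := by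
  have h : (Measure.map F (volume : Measure Euc2)).IsAddHaarMeasure :=
    F.isAddHaarMeasure_map volume
  have h2 := Measure.isAddLeftInvariant_eq_smul (Measure.map F (volume : Measure Euc2))
    (volume : Measure (ℝ × ℝ))
  exact ⟨_, h2⟩

lemma main_construction (M : Matrix (Fin 2) (Fin 2) ℝ) (l : Fin 3 → ℝ) (hl : ∀ k, 0 < l k)
    (hs : ∑ k, l k = 1) (hA : symPart M = ∑ k, l k • hexWells k) (i : Fin 3)
    (hi : 64/225 < l i) :
    ∃ (Ωδ : Set Euc2) (u : Euc2 → Euc2) (L : NNReal) (et : Fin 4 → Matrix (Fin 2) (Fin 2) ℝ),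
      IsOpenRectangle Ωδ ∧ LipschitzWith L u ∧
      (∀ k, inIntConv (et k)) ∧
      (∀ᵐ x ∂(volume : Measure Euc2), x ∈ Ωδ →
        symPart (grad2 u x) ∈ insert (hexWells i) (Set.range et)) ∧
      volume {x ∈ Ωδ | symPart (grad2 u x) = hexWells i} = volume Ωδ / 4 ∧
      EqOn u (matVec2 M) Ωδᶜ := by
  set A := symPart M with hAdef
  set Q := hexWells i - A with hQdef
  obtain ⟨qa, qb, hq⟩ : ∃ qa qb : ℝ, Q = !![qa, qb; qb, -qa] := by
    have h1 : hexWells i = ∑ k, (if k = i then (1:ℝ) else 0) • hexWells k := by simp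
    have h2 : Q = ∑ k, ((if k = i then (1:ℝ) else 0) - l k) • hexWells k := by
      rw [hQdef, hA]
      conv_lhs => rw [h1]
      rw [← Finset.sum_sub_distrib]
      exact Finset.sum_congr rfl fun k _ => (sub_smul _ _ _).symm
    rw [h2, hex_sum_entries (fun k => (if k = i then (1:ℝ) else 0) - l k)]
    exact ⟨_, _, rfl⟩
  obtain ⟨ρ, c, s, hcs, e1, e2⟩ := polar qa qb
  have hQ : Q = !![-(ρ * (2 * s * c)), ρ * (c ^ 2 - s ^ 2);
      ρ * (c ^ 2 - s ^ 2), ρ * (2 * s * c)] := by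
    rw [hq, e1, e2, neg_neg]
  set R : Matrix (Fin 2) (Fin 2) ℝ := !![2 * ρ * (c ^ 2 - s ^ 2), 2 * ρ * (2 * s * c);
      2 * ρ * (2 * s * c), -(2 * ρ * (c ^ 2 - s ^ 2))] with hR
  obtain ⟨r, hr, hRr⟩ := tracefree_bary (2 * ρ * (c ^ 2 - s ^ 2)) (2 * ρ * (2 * s * c))
  obtain ⟨d, hd, hpos⟩ := choose_delta l r hl hs i hi
  set N := 1 + 64/225 * d ^ 2 with hN
  have hN0 : N ≠ 0 := by positivity
  set A0 := 2 * ρ / N with hA0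
  set F := phi c s d hcs hd.ne' with hF
  set V := VV F !₂[A0 * c, A0 * s] !₂[-(A0 * d * s), A0 * d * c] with hV
  set st : ℝ × ℝ × ℝ → Matrix (Fin 2) (Fin 2) ℝ := fun v =>
    A + ((v.2.1 + d ^ 2 * v.2.2) / N) • Q + (v.1 * d / N) • R with hst
  set vs : Fin 4 → ℝ × ℝ × ℝ := ![(-64/161, -64/161, 64/161), (64/161, -64/161, 64/161),
        (0, 1, -64/15), (0, -4/11, -64/15)] with hvs
  set et : Fin 4 → Matrix (Fin 2) (Fin 2) ℝ := fun k => st (vs k) with het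
  have hint : ∀ k, inIntConv (et k) := by
    intro k
    refine inInt_of A R l r hs hA hr hRr i _ _ (hpos (vs k) ?_)
    fin_cases k <;> simp [hvs]
  have hgr : ∀ p a1 b1 a2, LocAff (F p) a1 b1 a2 (-a1) →
      DifferentiableAt ℝ V p ∧ symPart (M + grad2 V p) = st (a1, b1, a2) := by
    intro p a1 b1 a2 h
    have h' := VV_grad c s d A0 hcs hd.ne' p a1 b1 a2 (-a1) h
    refine ⟨h'.differentiableAt, ?_⟩
    rw [grad2_of_hasFDerivAt h']
    simp only [matCLM_single]
    exact strain_eq M _ A Q R ρ c s d a1 b1 a2 A0 N hAdef hN0 hA0 hQ hR rfl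
  obtain ⟨KV, hVL⟩ := VV_lip F !₂[A0 * c, A0 * s] !₂[-(A0 * d * s), A0 * d * c]
  obtain ⟨κ, hκ⟩ := measure_transfer F
  have hFm : Measurable F := F.continuous.measurable
  have hvolS : ∀ S : Set (ℝ × ℝ), MeasurableSet S → volume (F ⁻¹' S) = κ * volume S := by
    intro S hS
    rw [← Measure.map_apply hFm hS, hκ]
    simp
  have hopen : IsOpen {p : Euc2 | |(F p).1| + |(F p).2| < 1} := by
    have : Continuous F := F.continuous
    exact isOpen_lt (by fun_prop) (by fun_prop)
  have hsubI : {p : Euc2 | |(F p).1| + |(F p).2| < 1} ⊆ interior (F ⁻¹' T0) := by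
    refine interior_maximal ?_ hopen
    intro p hp
    exact le_of_lt (show |(F p).1| + |(F p).2| < 1 from hp)
  have hbase : ∀ᵐ p ∂(volume : Measure Euc2), _ :=
    ae_of_ae_map hFm.aemeasurable (by rw [hκ]; exact Measure.ae_smul_measure base_ae κ)
  obtain ⟨Ω, u, L, g1, g2, g3, g4, g5⟩ := assembly M V KV hVL (F ⁻¹' T0) (F ⁻¹' D0)
    (T0_closed.preimage F.continuous) (‖(F.symm : ℝ × ℝ →L[ℝ] Euc2)‖ + 1) (by positivity)
    (by
      intro p hp
      have hp' : |(F p).1| + |(F p).2| ≤ 1 := hp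
      rw [Metric.mem_closedBall, dist_zero_right]
      have hn : ‖F p‖ ≤ 1 := by
        rw [Prod.norm_def, Real.norm_eq_abs, Real.norm_eq_abs]
        have := abs_nonneg (F p).1
        have := abs_nonneg (F p).2
        exact max_le (by linarith) (by linarith)
      have h1 := (F.symm : ℝ × ℝ →L[ℝ] Euc2).le_opNorm (F p)
      have h2 : (F.symm : ℝ × ℝ →L[ℝ] Euc2) (F p) = p := F.symm_apply_apply p
      rw [h2] at h1
      have h3 := norm_nonneg (F.symm : ℝ × ℝ →L[ℝ] Euc2)
      nlinarith)
    ⟨0, hsubI (by simp)⟩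
    (by
      intro p hp
      simp only [hV, VV]
      rw [v1_out hp, v2_out hp]
      simp)
    (hFm D0_meas) (preimage_mono D0_sub)
    (by
      rw [hvolS _ D0_meas, hvolS _ T0_closed.measurableSet, area_rel, div_eq_mul_inv,
        div_eq_mul_inv, mul_assoc])
    (hexWells i) (range et)
    (by
      rintro ⟨k, hk⟩
      exact hex_not_int i (hk ▸ hint k))
    (by
      filter_upwards [hbase] with p hp hT
      obtain ⟨b1, b2, b3⟩ := hp hT
      refine ⟨hsubI b1, ?_⟩
      by_cases hD : F p ∈ D0
      · have h := b2 hD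
        obtain ⟨k1, k2⟩ := hgr p 0 1 (64/225) (by simpa using h)
        refine ⟨k1, fun _ => ?_, fun hn => absurd hD hn⟩
        rw [k2, hst]
        have h1 : (1 + d ^ 2 * (64/225)) / N = 1 := by
          rw [hN, div_eq_one_iff_eq hN0]; ring
        simp only [h1]
        simp [hQdef]
      · have key : ∃ k, LocAff (F p) (vs k).1 (vs k).2.1 (vs k).2.2 (-(vs k).1) := by
          rcases b3 hD with h | h | h | h
          · refine ⟨0, ?_⟩
            simp only [hvs]
            convert h using 1 <;> norm_num
          · refine ⟨1, ?_⟩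
            simp only [hvs]
            convert h using 1 <;> norm_num
          · refine ⟨2, ?_⟩
            show LocAff (F p) 0 1 (-64/15) (-0)
            rw [neg_zero]
            exact h
          · refine ⟨3, ?_⟩
            show LocAff (F p) 0 (-4/11) (-64/15) (-0)
            rw [neg_zero]
            exact h
        obtain ⟨k, hk⟩ := key
        obtain ⟨k1, k2⟩ := hgr p _ _ _ hk
        refine ⟨k1, fun hn => absurd hn hD, fun _ => ?_⟩
        rw [k2]
        exact ⟨k, rfl⟩)
  exact ⟨Ω, u, L, et, g1, g2, hint, g3, g4, g5⟩

/-- The replacement construction from [RZZ16] (after Conti): given `M`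
with `e(M)` in the (relative) interior of `conv(K)`, `ε₀` small compared to the distance
of `e(M)` to `∂ conv(K)`, and a well `e⁽ⁱ⁾` almost realising `dist(e(M), K)`, there is a
(rotated) rectangle `Ω_δ(M)` and a Lipschitz map `u` whose strain takes the five values
`e⁽ⁱ⁾, ẽ₁, …, ẽ₄` in `Ω_δ(M)`, attaining `e⁽ⁱ⁾` on exactly a quarter of `Ω_δ(M)`,
with `u = Mx` outside `Ω_δ(M)`. -/
theorem statement7 (M : Matrix (Fin 2) (Fin 2) ℝ) (hM : inIntConv (symPart M))
    (ε₀ : ℝ) (hε₀ : ε₀ ∈ Set.Ioo 0 (distK2 (symPart M) relBdryConvHexK / 100))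
    (i : Fin 3)
    (hi : fro2 (symPart M - hexWells i) ≤ distK2 (symPart M) hexK + 4 * ε₀) :
    ∃ (Ωδ : Set Euc2) (u : Euc2 → Euc2) (L : NNReal) (et : Fin 4 → Matrix (Fin 2) (Fin 2) ℝ),
      IsOpenRectangle Ωδ ∧ LipschitzWith L u ∧
      (∀ k, inIntConv (et k)) ∧
      (∀ᵐ x ∂(volume : Measure Euc2), x ∈ Ωδ →
        symPart (grad2 u x) ∈ insert (hexWells i) (Set.range et)) ∧
      volume {x ∈ Ωδ | symPart (grad2 u x) = hexWells i} = volume Ωδ / 4 ∧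
      EqOn u (matVec2 M) Ωδᶜ := by
  obtain ⟨l, hl, hs, hA⟩ := hM
  exact main_construction M l hl hs hA i (bary_bound _ l hl hs hA ε₀ hε₀ i hi)
end
end

section
/- Let s ∈ (0,1), n ≥ 1, and let Ω ⊂ ℝⁿ be an open bounded domain with C^{1,1} boundary. For δ > 0 write Ω_δ := {x ∈ Ω : dist(x, ∂Ω) ≥ δ}. Then there exists a constant C = C(s, Ω, n) > 1 such that for every u ∈ H^s(ℝⁿ) with supp(u) ⊂ cl(Ω) and every δ > 0: ‖u‖_{L²(Ω_δ \ Ω_{2δ})} ≤ C δ^s ‖u‖_{H^s(ℝⁿ)}. -/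
noncomputable section
open MeasureTheory Set
open scoped ENNReal

abbrev Euc (n : ℕ) := EuclideanSpace ℝ (Fin n)

def matVec {n : ℕ} (M : Matrix (Fin n) (Fin n) ℝ) (x : Euc n) : Euc n :=
  WithLp.toLp 2 (fun i => ∑ j, M i j * x j)

def grad {n : ℕ} (w : Euc n → Euc n) (x : Euc n) : Matrix (Fin n) (Fin n) ℝ :=
  fun i j => fderiv ℝ w x (EuclideanSpace.single j 1) i

def fro {n : ℕ} (A : Matrix (Fin n) (Fin n) ℝ) : ℝ :=
  Real.sqrt (∑ i, ∑ j, (A i j)^2)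

def distK {n : ℕ} (A : Matrix (Fin n) (Fin n) ℝ) (K : Set (Matrix (Fin n) (Fin n) ℝ)) : ℝ :=
  sInf ((fun B => fro (A - B)) '' K)

def pdv {n : ℕ} (k : Fin n) (f : Euc n → ℝ) (x : Euc n) : ℝ :=
  fderiv ℝ f x (EuclideanSpace.single k 1)

def hessSq {n : ℕ} (w : Euc n → Euc n) (x : Euc n) : ℝ :=
  ∑ i, ∑ j, ∑ k, (pdv k (fun y => grad w y i j) x)^2

def IsC11Domain {n : ℕ} (Ω : Set (Euc n)) : Prop :=
  ∃ r > (0:ℝ), ∀ x ∈ frontier Ω,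
    (∃ c, Metric.ball c r ⊆ Ω ∧ dist x c = r) ∧
    (∃ c, Metric.ball c r ⊆ (closure Ω)ᶜ ∧ dist x c = r)

def GradBddAe {n : ℕ} (v : Euc n → Euc n) : Prop :=
  ∃ C : ℝ, ∀ᵐ x ∂(volume : Measure (Euc n)), fro (grad v x) ≤ C

def ftP {n : ℕ} (f : Euc n → ℂ) (k : Euc n) : ℂ :=
  ∫ x : Euc n, Complex.exp (Complex.I * ((inner ℝ k x : ℝ) : ℂ)) * f x

def MemHsC {n : ℕ} (s : ℝ) (f : Euc n → ℂ) : Prop :=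
  Integrable f ∧ Integrable (fun ξ : Euc n => (1 + ‖ξ‖^2) ^ s * ‖ftP f ξ‖^2)

def HsNormC {n : ℕ} (s : ℝ) (f : Euc n → ℂ) : ℝ :=
  (∫ ξ : Euc n, (1 + ‖ξ‖^2) ^ s * ‖ftP f ξ‖^2) ^ (1/2 : ℝ)

def MemHs {n : ℕ} (s : ℝ) (f : Euc n → ℝ) : Prop := MemHsC s (fun x => (f x : ℂ))

def HsNorm {n : ℕ} (s : ℝ) (f : Euc n → ℝ) : ℝ := HsNormC s (fun x => (f x : ℂ))

/-- The regularised energy `E_ε`, as an extended real number: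
the infimum over all `w` with `∇w = M` a.e. outside `cl Ω` of
`∫_Ω dist²(∇w, K) + ε² ∫_Ω |∇²w|²`. -/
def energyDiff {n : ℕ} (Ω : Set (Euc n)) (K : Set (Matrix (Fin n) (Fin n) ℝ))
    (M : Matrix (Fin n) (Fin n) ℝ) (ε : ℝ) : ℝ≥0∞ :=
  sInf {e : ℝ≥0∞ | ∃ w : Euc n → Euc n,
    (∀ᵐ x ∂(volume : Measure (Euc n)), x ∉ closure Ω → grad w x = M) ∧
    e = (∫⁻ x in Ω, ENNReal.ofReal ((distK (grad w x) K)^2))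
        + ENNReal.ofReal (ε^2) * ∫⁻ x in Ω, ENNReal.ofReal (hessSq w x)}

section Aux

open scoped FourierTransform SchwartzMap

lemma aux_planch {n : ℕ} (f : Euc n → ℂ) (hf : Integrable f) :
    ∫⁻ x, ‖f x‖ₑ ^ 2 ≤ ∫⁻ x, ‖𝓕 f x‖ₑ ^ 2 := by
  have hcont : Continuous (𝓕 f) :=
    VectorFourier.fourierIntegral_continuous Real.continuous_fourierChar
      (by exact continuous_inner) hf
  by_cases htop : ∫⁻ x, ‖𝓕 f x‖ₑ ^ 2 = ∞
  · rw [htop]; exact le_top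
  have hsq : ∀ g : Euc n → ℂ, eLpNorm g 2 volume ^ 2 = ∫⁻ x, ‖g x‖ₑ ^ 2 := by
    intro g
    have := eLpNorm_nnreal_pow_eq_lintegral (f := g) (p := 2) (μ := volume) (by norm_num)
    simpa using this
  have hmem : MemLp (𝓕 f) 2 := by
    refine ⟨hcont.aestronglyMeasurable, ?_⟩
    rw [lt_top_iff_ne_top]
    intro h
    apply htop
    rw [← hsq, h]; simp
  set F : Lp ℂ 2 (volume : Measure (Euc n)) := hmem.toLp (𝓕 f) with hF
  set v : Lp ℂ 2 (volume : Measure (Euc n)) := 𝓕⁻ F with hv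
  have hFv : 𝓕 v = F := FourierTransform.fourier_fourierInv_eq F
  have key : ∀ φ : 𝓢(Euc n, ℂ), ∫ x, φ x • f x = ∫ x, φ x • v x := by
    intro φ
    have h1 : ∫ x, φ x • v x = Lp.toTemperedDistribution v φ := by simp
    have h2 : Lp.toTemperedDistribution v φ = (𝓕 (Lp.toTemperedDistribution v)) (𝓕⁻ φ) := by
      rw [TemperedDistribution.fourier_apply, FourierTransform.fourier_fourierInv_eq]
    have h3 : ∫ x, (𝓕⁻ φ) x • F x = ∫ x, (𝓕⁻ φ) x • 𝓕 f x := by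
      apply integral_congr_ae
      filter_upwards [hmem.coeFn_toLp] with x hx
      rw [hx]
    rw [h1, h2, Lp.fourier_toTemperedDistribution_eq, hFv, Lp.toTemperedDistribution_apply, h3]
    have h4 := VectorFourier.integral_fourierIntegral_smul_eq_flip (μ := (volume : Measure (Euc n)))
      (ν := (volume : Measure (Euc n))) (L := innerₗ (Euc n)) (f := (𝓕⁻ φ : 𝓢(Euc n, ℂ))) (g := f)
      Real.continuous_fourierChar (by exact continuous_inner) (SchwartzMap.integrable _) hf
    rw [flip_innerₗ] at h4
    have h5 : VectorFourier.fourierIntegral Real.fourierChar volume (innerₗ (Euc n))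
        (𝓕⁻ φ : 𝓢(Euc n, ℂ)) = φ := by
      have : 𝓕 (𝓕⁻ φ) = φ := FourierTransform.fourier_fourierInv_eq φ
      conv_rhs => rw [← this]
      rw [SchwartzMap.fourier_coe]; rfl
    rw [h5] at h4
    exact h4
  have hae : ∀ᵐ x, f x = v x := by
    apply ae_eq_of_integral_contDiff_smul_eq hf.locallyIntegrable
    · exact (Lp.memLp v).locallyIntegrable (by norm_num)
    · intro g hg hc
      have hc' : HasCompactSupport (fun x => (g x : ℂ)) := hc.comp_left (g := fun y : ℝ => (y : ℂ)) (by simp)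
      have hg' : ContDiff ℝ ((⊤ : ℕ∞) : WithTop ℕ∞) (fun x => (g x : ℂ)) := Complex.ofRealCLM.contDiff.comp hg
      simpa using key (hc'.toSchwartzMap hg')
  have hnorm : eLpNorm f 2 volume = eLpNorm (𝓕 f) 2 volume := by
    rw [eLpNorm_congr_ae hae, eLpNorm_congr_ae hmem.coeFn_toLp.symm, ← hF, ← hFv]
    have := Lp.norm_fourier_eq v
    rw [Lp.norm_def, Lp.norm_def, ENNReal.toReal_eq_toReal_iff' (Lp.eLpNorm_ne_top _) (Lp.eLpNorm_ne_top _)] at this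
    exact this.symm
  rw [← hsq, ← hsq, hnorm]

lemma aux_ft {n : ℕ} (f : Euc n → ℂ) (η : Euc n) :
    ftP f ((-(2 * Real.pi)) • η) = 𝓕 f η := by
  rw [ftP, Real.fourier_eq']
  congr 1
  ext x
  rw [smul_eq_mul, inner_smul_left, real_inner_comm]
  congr 2
  simp
  ring

lemma aux_scale {n : ℕ} (s : ℝ) (f : Euc n → ℂ) (hf : MemHsC s f) :
    ∫⁻ η : Euc n, ENNReal.ofReal ((1 + (2 * Real.pi * ‖η‖) ^ 2) ^ s * ‖𝓕 f η‖ ^ 2) ≤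
      ENNReal.ofReal (∫ ξ : Euc n, (1 + ‖ξ‖^2) ^ s * ‖ftP f ξ‖^2) := by
  set G : Euc n → ℝ := fun ξ => (1 + ‖ξ‖^2) ^ s * ‖ftP f ξ‖^2 with hG
  have hGn : ∀ ξ, 0 ≤ G ξ := fun ξ => by positivity
  have hpi := Real.pi_pos
  have hne : (-(2 * Real.pi)) ≠ 0 := by linarith
  have h1 : ∀ η : Euc n, (1 + (2 * Real.pi * ‖η‖) ^ 2) ^ s * ‖𝓕 f η‖ ^ 2
      = G ((-(2 * Real.pi)) • η) := by
    intro η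
    simp only [hG]
    rw [aux_ft, norm_smul, norm_neg, Real.norm_of_nonneg (by positivity)]
  simp_rw [h1]
  have hi : Integrable (fun η => G ((-(2 * Real.pi)) • η)) :=
    (integrable_comp_smul_iff volume G hne).2 hf.2
  rw [← ofReal_integral_eq_lintegral_ofReal hi (Filter.Eventually.of_forall fun _ => hGn _)]
  apply ENNReal.ofReal_le_ofReal
  rw [Measure.integral_comp_smul, smul_eq_mul]
  apply mul_le_of_le_one_left (integral_nonneg hGn)
  rw [abs_inv, abs_pow, abs_neg, abs_of_pos (by positivity)]
  apply inv_le_one_of_one_le₀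
  apply one_le_pow₀
  linarith [Real.pi_gt_three]

lemma aux_l2 {n : ℕ} (s : ℝ) (hs : 0 < s) (f : Euc n → ℂ) (hf : MemHsC s f) :
    ∫⁻ x, ‖f x‖ₑ ^ 2 ≤ ENNReal.ofReal (∫ ξ : Euc n, (1 + ‖ξ‖^2) ^ s * ‖ftP f ξ‖^2) := by
  refine (aux_planch f hf.1).trans (le_trans ?_ (aux_scale s f hf))
  apply lintegral_mono
  intro η
  simp only
  rw [← ofReal_norm, ← ENNReal.ofReal_pow (norm_nonneg _)]
  apply ENNReal.ofReal_le_ofReal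
  apply le_mul_of_one_le_left (by positivity)
  apply Real.one_le_rpow _ hs.le
  nlinarith [sq_nonneg (2 * Real.pi * ‖η‖)]

lemma aux_min (s : ℝ) (hs : s ∈ Ioo (0:ℝ) 1) (a t : ℝ) (ha : 0 ≤ a) (h2 : a ≤ 2) (hat : a ≤ t) :
    a ^ 2 ≤ 4 * (t ^ 2) ^ s := by
  have ht : 0 ≤ t := ha.trans hat
  rcases le_total t 1 with h | h
  · have h1 : t ^ 2 ≤ 1 := by nlinarith
    have h3 : t ^ 2 ≤ (t ^ 2) ^ s := by
      rcases ht.eq_or_lt with h0 | h0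
      · rw [← h0]; simp; positivity
      · simpa using Real.rpow_le_rpow_of_exponent_ge (by positivity) h1 hs.2.le
    nlinarith
  · have : 1 ≤ (t ^ 2) ^ s := Real.one_le_rpow (by nlinarith) hs.1.le
    nlinarith

lemma aux_diff {n : ℕ} (s : ℝ) (hs : s ∈ Ioo (0:ℝ) 1) (f : Euc n → ℂ) (hf : MemHsC s f)
    (h : Euc n) :
    ∫⁻ x, ‖f (x + h) - f x‖ₑ ^ 2 ≤ ENNReal.ofReal (4 * (‖h‖ ^ 2) ^ s) *
      ENNReal.ofReal (∫ ξ : Euc n, (1 + ‖ξ‖^2) ^ s * ‖ftP f ξ‖^2) := by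
  have hi : Integrable (fun x => f (x + h)) := hf.1.comp_add_right h
  refine (aux_planch (fun x => f (x + h) - f x) (hi.sub hf.1)).trans ?_
  have hft : ∀ η, 𝓕 (fun x => f (x + h) - f x) η
      = (Complex.exp (Complex.I * ((2 * Real.pi * inner ℝ h η : ℝ) : ℂ)) - 1) * 𝓕 f η := by
    intro η
    have e1 : 𝓕 (fun x => f (x + h)) η
        = Complex.exp (Complex.I * ((2 * Real.pi * inner ℝ h η : ℝ) : ℂ)) * 𝓕 f η := by
      have := congrFun (VectorFourier.fourierIntegral_comp_add_right Real.fourierChar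
        (volume : Measure (Euc n)) (innerₗ (Euc n)) f h) η
      refine this.trans ?_
      rw [Circle.smul_def, Real.fourierChar_apply, smul_eq_mul, mul_comm Complex.I]
      rfl
    have e2 : 𝓕 (fun x => f (x + h) - f x) η = 𝓕 (fun x => f (x + h)) η - 𝓕 f η := by
      simp only [Real.fourier_eq, smul_sub]
      apply integral_sub
      · exact (Real.fourierIntegral_convergent_iff η).2 hi
      · exact (Real.fourierIntegral_convergent_iff η).2 hf.1
    rw [e2, e1]; ring
  refine le_trans ?_ (mul_le_mul_right (aux_scale s f hf) _)
  rw [← lintegral_const_mul' _ _ ENNReal.ofReal_ne_top]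
  apply lintegral_mono
  intro η
  simp only
  rw [hft, ← ofReal_norm, ← ENNReal.ofReal_pow (norm_nonneg _), ← ENNReal.ofReal_mul (by positivity)]
  apply ENNReal.ofReal_le_ofReal
  rw [norm_mul, mul_pow, ← mul_assoc]
  apply mul_le_mul_of_nonneg_right _ (by positivity)
  have hpi := Real.pi_pos
  have hb := aux_min s hs ‖Complex.exp (Complex.I * ((2 * Real.pi * inner ℝ h η : ℝ) : ℂ)) - 1‖
    (‖h‖ * (2 * Real.pi * ‖η‖)) (norm_nonneg _) ?_ ?_
  · refine hb.trans ?_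
    rw [mul_pow, Real.mul_rpow (by positivity) (by positivity), ← mul_assoc]
    apply mul_le_mul_of_nonneg_left _ (by positivity)
    apply Real.rpow_le_rpow (by positivity) _ hs.1.le
    linarith
  · refine (norm_sub_le _ _).trans ?_
    rw [mul_comm Complex.I, Complex.norm_exp_ofReal_mul_I]
    norm_num
  · refine Real.norm_exp_I_mul_ofReal_sub_one_le.trans ?_
    rw [norm_mul, Real.norm_of_nonneg (by positivity)]
    have := norm_inner_le_norm (𝕜 := ℝ) h η
    nlinarith

lemma aux_ball {n : ℕ} {Ω : Set (Euc n)} {r : ℝ} 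
    (hreg : ∀ x ∈ frontier Ω, ∃ c, Metric.ball c r ⊆ (closure Ω)ᶜ ∧ dist x c = r)
    {δ : ℝ} (hδ : 0 < δ) (hδr : δ ≤ r) (x : Euc n)
    (h1 : δ ≤ Metric.infDist x (frontier Ω)) (h2 : Metric.infDist x (frontier Ω) < 2 * δ) :
    ∃ c, Metric.ball c δ ⊆ (closure Ω)ᶜ ∧ Metric.ball (c - x) δ ⊆ Metric.ball 0 (4 * δ) := by
  have hne : (frontier Ω).Nonempty := by
    by_contra hcon
    rw [not_nonempty_iff_eq_empty] at hcon
    rw [hcon, Metric.infDist_empty] at h1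
    linarith
  obtain ⟨y, hy, hxy⟩ := isClosed_frontier.exists_infDist_eq_dist hne x
  obtain ⟨c, hc, hyc⟩ := hreg y hy
  have hr : 0 < r := hδ.trans_le hδr
  have hyc' : ‖c - y‖ = r := by rw [← hyc, dist_comm, dist_eq_norm]
  refine ⟨y + (δ / r) • (c - y), ?_, ?_⟩
  · refine (Metric.ball_subset_ball' ?_).trans hc
    rw [dist_eq_norm]
    have : y + (δ / r) • (c - y) - c = (δ / r - 1) • (c - y) := by module
    rw [this, norm_smul, hyc', Real.norm_eq_abs, abs_of_nonpos (by rw [sub_nonpos]; exact (div_le_one hr).2 hδr)]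
    field_simp
    linarith
  · apply Metric.ball_subset_ball'
    rw [dist_zero_right]
    have e : y + (δ / r) • (c - y) - x = (y - x) + (δ / r) • (c - y) := by module
    have e1 : ‖y - x‖ < 2 * δ := by rw [← dist_eq_norm, dist_comm, ← hxy]; exact h2
    have e2 : ‖(δ / r) • (c - y)‖ = δ := by
      rw [norm_smul, hyc', Real.norm_of_nonneg (by positivity)]; field_simp
    rw [e]
    linarith [norm_add_le (y - x) ((δ / r) • (c - y))]

lemma aux_small {n : ℕ} (s : ℝ) (hs : s ∈ Ioo (0:ℝ) 1) {Ω : Set (Euc n)} {r : ℝ}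
    (hreg : ∀ x ∈ frontier Ω, ∃ c, Metric.ball c r ⊆ (closure Ω)ᶜ ∧ dist x c = r)
    {δ : ℝ} (hδ : 0 < δ) (hδr : δ ≤ r) (f : Euc n → ℂ) (hf : MemHsC s f)
    (hsupp : ∀ x ∉ closure Ω, f x = 0) (A : Set (Euc n)) (hA : MeasurableSet A)
    (hA1 : ∀ x ∈ A, δ ≤ Metric.infDist x (frontier Ω))
    (hA2 : ∀ x ∈ A, Metric.infDist x (frontier Ω) < 2 * δ) :
    ∫⁻ x in A, ‖f x‖ₑ ^ 2 ≤ ENNReal.ofReal (4 ^ n * (4 * ((4 * δ) ^ 2) ^ s)) *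
      ENNReal.ofReal (∫ ξ : Euc n, (1 + ‖ξ‖^2) ^ s * ‖ftP f ξ‖^2) := by
  set J := ENNReal.ofReal (∫ ξ : Euc n, (1 + ‖ξ‖^2) ^ s * ‖ftP f ξ‖^2)
  set V := volume (Metric.ball (0 : Euc n) δ) with hV
  have hV0 : V ≠ 0 := (Metric.measure_ball_pos _ _ hδ).ne'
  have hVt : V ≠ ∞ := measure_ball_lt_top.ne
  have hV4 : volume (Metric.ball (0 : Euc n) (4 * δ)) = ENNReal.ofReal (4 ^ n) * V := by
    rw [Measure.addHaar_ball_mul_of_pos _ _ (by norm_num)]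
    simp [hV]
  have hpt : ∀ x ∈ A, V * ‖f x‖ₑ ^ 2 ≤
      ∫⁻ h in Metric.ball (0 : Euc n) (4 * δ), ‖f (x + h) - f x‖ₑ ^ 2 := by
    intro x hx
    obtain ⟨c, hc1, hc2⟩ := aux_ball hreg hδ hδr x (hA1 x hx) (hA2 x hx)
    refine le_trans (le_of_eq ?_) (lintegral_mono_set hc2)
    have : ∀ h ∈ Metric.ball (c - x) δ, ‖f (x + h) - f x‖ₑ ^ 2 = ‖f x‖ₑ ^ 2 := by
      intro h hh
      have h1 : x + h ∈ Metric.ball c δ := by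
        rw [Metric.mem_ball, dist_eq_norm] at hh ⊢
        convert hh using 2
        abel
      rw [hsupp _ (hc1 h1), zero_sub, enorm_neg]
    rw [setLIntegral_congr_fun measurableSet_ball this, setLIntegral_const,
      Measure.addHaar_ball_center, mul_comm]
  have hmeas : AEMeasurable (Function.uncurry fun (x h : Euc n) => ‖f (x + h) - f x‖ₑ ^ 2)
      ((volume.restrict A).prod (volume.restrict (Metric.ball (0 : Euc n) (4 * δ)))) := by
    have h0 : AEMeasurable (fun p : Euc n × Euc n => ‖f (p.1 + p.2) - f p.1‖ₑ ^ 2)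
        ((volume : Measure (Euc n)).prod (volume : Measure (Euc n))) := by
      have hm := hf.1.aestronglyMeasurable
      have a1 : AEStronglyMeasurable (fun p : Euc n × Euc n => f (p.1 + p.2))
          ((volume : Measure (Euc n)).prod (volume : Measure (Euc n))) :=
        hm.comp_quasiMeasurePreserving (quasiMeasurePreserving_add _ _)
      exact ((a1.sub hm.comp_fst).enorm).pow_const 2
    rw [Measure.prod_restrict]
    exact h0.mono_measure Measure.restrict_le_self
  have hmain : V * ∫⁻ x in A, ‖f x‖ₑ ^ 2 ≤
      V * (ENNReal.ofReal (4 ^ n * (4 * ((4 * δ) ^ 2) ^ s)) * J) := by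
    rw [← lintegral_const_mul' _ _ hVt]
    calc _ ≤ ∫⁻ x in A, ∫⁻ h in Metric.ball (0 : Euc n) (4 * δ), ‖f (x + h) - f x‖ₑ ^ 2 :=
          setLIntegral_mono' hA hpt
      _ = ∫⁻ h in Metric.ball (0 : Euc n) (4 * δ), ∫⁻ x in A, ‖f (x + h) - f x‖ₑ ^ 2 :=
          lintegral_lintegral_swap hmeas
      _ ≤ ∫⁻ h in Metric.ball (0 : Euc n) (4 * δ), ENNReal.ofReal (4 * ((4 * δ) ^ 2) ^ s) * J := by
          apply setLIntegral_mono' measurableSet_ball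
          intro h hh
          refine (setLIntegral_le_lintegral _ _).trans ((aux_diff s hs f hf h).trans ?_)
          gcongr
          · exact hs.1.le
          · rw [mem_ball_zero_iff] at hh; exact hh.le
      _ = _ := by
          rw [setLIntegral_const, hV4, ENNReal.ofReal_mul (p := 4 ^ n) (by positivity)]
          ring
  exact (ENNReal.mul_le_mul_iff_right hV0 hVt).1 hmain

end Aux

/-- Fractional Poincaré inequality: for `u ∈ H^s(ℝⁿ)` supported in the
closure of a bounded `C^{1,1}` domain `Ω`,
`‖u‖_{L²(Ω_δ \ Ω_{2δ})} ≤ C δ^s ‖u‖_{H^s(ℝⁿ)}`, where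
`Ω_δ = {x ∈ Ω : dist(x, ∂Ω) ≥ δ}`. -/
theorem statement9 {n : ℕ} (hn : 1 ≤ n) (s : ℝ) (hs : s ∈ Ioo (0:ℝ) 1)
    (Ω : Set (Euc n)) (hΩo : IsOpen Ω) (hΩb : Bornology.IsBounded Ω)
    (hΩreg : IsC11Domain Ω) :
    ∃ C : ℝ, 1 < C ∧
      ∀ (u : Euc n → ℝ), MemHs s u → Function.support u ⊆ closure Ω →
        ∀ δ : ℝ, 0 < δ →
        (∫ x in ({x ∈ Ω | δ ≤ Metric.infDist x (frontier Ω)} \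
                 {x ∈ Ω | 2 * δ ≤ Metric.infDist x (frontier Ω)}), (u x)^2) ^ (1/2 : ℝ)
          ≤ C * δ ^ s * HsNorm s u := by
  obtain ⟨r, hr, hreg⟩ := hΩreg
  have hrs : 0 < r ^ (-s) := Real.rpow_pos_of_pos hr _
  have h2n : (1:ℝ) ≤ 2 ^ n := one_le_pow₀ (by norm_num)
  refine ⟨8 * 2 ^ n + r ^ (-s), by linarith, ?_⟩
  intro u hu hsupp δ hδ
  set A := ({x ∈ Ω | δ ≤ Metric.infDist x (frontier Ω)} \
                 {x ∈ Ω | 2 * δ ≤ Metric.infDist x (frontier Ω)}) with hA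
  set f : Euc n → ℂ := fun x => (u x : ℂ) with hf
  have hfH : MemHsC s f := hu
  set I : ℝ := ∫ ξ : Euc n, (1 + ‖ξ‖^2) ^ s * ‖ftP f ξ‖^2 with hI
  have hI0 : 0 ≤ I := integral_nonneg fun ξ => by positivity
  have hδs : 0 < δ ^ s := Real.rpow_pos_of_pos hδ _
  have hnorm : HsNorm s u = I ^ (1/2 : ℝ) := rfl
  have hAm : MeasurableSet A := by
    have hc : Measurable fun x : Euc n => Metric.infDist x (frontier Ω) :=
      (Metric.continuous_infDist_pt _).measurable
    exact (hΩo.measurableSet.inter (measurableSet_le measurable_const hc)).diff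
      (hΩo.measurableSet.inter (measurableSet_le measurable_const hc))
  have hA1 : ∀ x ∈ A, δ ≤ Metric.infDist x (frontier Ω) := fun x hx => hx.1.2
  have hA2 : ∀ x ∈ A, Metric.infDist x (frontier Ω) < 2 * δ := by
    intro x hx
    by_contra hcon
    exact hx.2 ⟨hx.1.1, not_lt.1 hcon⟩
  have hfs : ∀ x ∉ closure Ω, f x = 0 := by
    intro x hx
    have : u x = 0 := by
      by_contra hcon
      exact hx (hsupp hcon)
    simp [hf, this]
  have hum : AEStronglyMeasurable u volume := by
    have := hfH.1.aestronglyMeasurable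
    exact Complex.continuous_re.comp_aestronglyMeasurable this
  have hint : ∫ x in A, (u x)^2 = (∫⁻ x in A, ‖f x‖ₑ ^ 2).toReal := by
    rw [integral_eq_lintegral_of_nonneg_ae (Filter.Eventually.of_forall fun x => sq_nonneg (u x))
      (hum.restrict.pow 2)]
    congr 1
    apply lintegral_congr
    intro x
    rw [← ofReal_norm, ← ENNReal.ofReal_pow (norm_nonneg _)]
    simp [hf]
  have hbound : ∫⁻ x in A, ‖f x‖ₑ ^ 2 ≤
      ENNReal.ofReal (((8 * 2 ^ n + r ^ (-s)) * δ ^ s) ^ 2 * I) := by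
    rcases le_total δ r with hle | hle
    · refine (aux_small s hs (fun x hx => (hreg x hx).2) hδ hle f hfH hfs A hAm hA1 hA2).trans ?_
      rw [← ENNReal.ofReal_mul (by positivity)]
      apply ENNReal.ofReal_le_ofReal
      apply mul_le_mul_of_nonneg_right _ hI0
      have e1 : ((4 * δ) ^ 2) ^ s = (16:ℝ) ^ s * (δ ^ s) ^ 2 := by
        rw [mul_pow, Real.mul_rpow (by positivity) (by positivity), ← Real.rpow_natCast δ 2,
          ← Real.rpow_natCast (δ ^ s) 2, ← Real.rpow_mul hδ.le, ← Real.rpow_mul hδ.le, mul_comm s]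
        norm_num
      have e2 : (16:ℝ) ^ s ≤ 16 := by
        simpa using Real.rpow_le_rpow_of_exponent_le (x := 16) (by norm_num) hs.2.le
      have e3 : (4:ℝ) ^ n = (2 ^ n) ^ 2 := by rw [← pow_mul, mul_comm, pow_mul]; norm_num
      rw [e1, e3]
      calc ((2:ℝ) ^ n) ^ 2 * (4 * (16 ^ s * (δ ^ s) ^ 2))
          ≤ ((2:ℝ) ^ n) ^ 2 * (4 * (16 * (δ ^ s) ^ 2)) := by gcongr
        _ = (8 * 2 ^ n * δ ^ s) ^ 2 := by ring
        _ ≤ _ := by gcongr; linarith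
    · refine (setLIntegral_le_lintegral _ _).trans ((aux_l2 s hs.1 f hfH).trans ?_)
      apply ENNReal.ofReal_le_ofReal
      apply le_mul_of_one_le_left hI0
      apply one_le_pow₀
      have e1 : r ^ (-s) * r ^ s = 1 := by rw [← Real.rpow_add hr]; simp
      have e2 : r ^ s ≤ δ ^ s := Real.rpow_le_rpow hr.le hle hs.1.le
      have e3 : r ^ (-s) * r ^ s ≤ r ^ (-s) * δ ^ s := by gcongr
      have e4 : 0 ≤ 8 * 2 ^ n * δ ^ s := by positivity
      linarith
  have hfin : ∫ x in A, (u x)^2 ≤ ((8 * 2 ^ n + r ^ (-s)) * δ ^ s) ^ 2 * I := by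
    rw [hint]
    exact ENNReal.toReal_le_of_le_ofReal (by positivity) hbound
  rw [hnorm, ← Real.sqrt_eq_rpow, ← Real.sqrt_eq_rpow]
  refine (Real.sqrt_le_sqrt hfin).trans (le_of_eq ?_)
  rw [Real.sqrt_mul (by positivity), Real.sqrt_sq (by positivity)]
end
end

section
/- Let s ∈ (0,1), p ∈ (1,∞), n ≥ 1, and let Ω ⊂ ℝⁿ be an open bounded domain with C^{1,1} boundary. For δ > 0 write Ω_δ := {x ∈ Ω : dist(x, ∂Ω) ≥ δ}. Then there exists a constant C = C(s, p, Ω, n) > 1 such that for every u ∈ W^{s,p}(ℝⁿ) with supp(u) ⊂ cl(Ω) and every δ > 0: ‖u‖_{L^p(Ω_δ \ Ω_{2δ})} ≤ C δ^s ‖u‖_{W^{s,p}(ℝⁿ)}. -/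
noncomputable section
open MeasureTheory Set
open scoped ENNReal

/-- Membership in `W^{s,p}(ℝⁿ)`, `s ∈ (0,1)`, via the Gagliardo norm. -/
def MemGag {n : ℕ} (s p : ℝ) (f : Euc n → ℝ) : Prop :=
  Integrable (fun x : Euc n => |f x| ^ p) ∧
    Integrable (fun q : Euc n × Euc n =>
      |f q.1 - f q.2| ^ p / dist q.1 q.2 ^ ((n : ℝ) + s * p))

/-- The `W^{s,p}(ℝⁿ)` (Gagliardo) norm, `s ∈ (0,1)`. -/
def gagNorm {n : ℕ} (s p : ℝ) (f : Euc n → ℝ) : ℝ :=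
  ((∫ x : Euc n, |f x| ^ p) +
    ∫ q : Euc n × Euc n, |f q.1 - f q.2| ^ p / dist q.1 q.2 ^ ((n : ℝ) + s * p)) ^ (1/p)

/-- Exterior ball of radius `δ` close to a point at distance `< 2δ` from the boundary. -/
lemma exists_ext_ball {n : ℕ} (Ω : Set (Euc n)) (r : ℝ) (hr : 0 < r)
    (hext : ∀ x ∈ frontier Ω, ∃ c, Metric.ball c r ⊆ (closure Ω)ᶜ ∧ dist x c = r)
    (δ : ℝ) (hδ : 0 < δ) (hδr : δ ≤ r) (x : Euc n)
    (h1 : δ ≤ Metric.infDist x (frontier Ω)) (h2 : Metric.infDist x (frontier Ω) < 2 * δ) :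
    ∃ c, Metric.ball c δ ⊆ (closure Ω)ᶜ ∧ ∀ y ∈ Metric.ball c δ, dist x y ≤ 4 * δ := by
  have hne : (frontier Ω).Nonempty := by
    by_contra h
    rw [Set.not_nonempty_iff_eq_empty] at h
    rw [h, Metric.infDist_empty] at h1
    linarith
  obtain ⟨z, hz, hxz⟩ := (Metric.infDist_lt_iff hne).1 h2
  obtain ⟨c, hc, hzc⟩ := hext z hz
  have hcz : ‖c - z‖ = r := by rw [← hzc, dist_eq_norm, norm_sub_rev]
  have e1 : dist (z + (δ / r) • (c - z)) z = δ := by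
    rw [dist_eq_norm, add_sub_cancel_left, norm_smul, hcz, Real.norm_of_nonneg (by positivity)]
    field_simp
  have e2 : dist (z + (δ / r) • (c - z)) c = r - δ := by
    have : z + (δ / r) • (c - z) - c = (δ / r - 1) • (c - z) := by module
    rw [dist_eq_norm, this, norm_smul, hcz, Real.norm_of_nonpos]
    · field_simp
      ring
    · have : δ / r ≤ 1 := (div_le_one hr).2 hδr
      linarith
  refine ⟨z + (δ / r) • (c - z), ?_, ?_⟩
  · refine (Metric.ball_subset_ball' ?_).trans hc
    rw [e2]; linarith
  · intro y hy
    rw [Metric.mem_ball] at hy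
    have t1 := dist_triangle x z y
    have t2 := dist_triangle z (z + (δ / r) • (c - z)) y
    rw [dist_comm] at hy
    rw [dist_comm] at e1
    linarith

theorem statement10 {n : ℕ} (hn : 1 ≤ n) (s p : ℝ) (hs : s ∈ Ioo (0:ℝ) 1)
    (hp : 1 < p)
    (Ω : Set (Euc n)) (hΩo : IsOpen Ω) (hΩb : Bornology.IsBounded Ω)
    (hΩreg : IsC11Domain Ω) :
    ∃ C : ℝ, 1 < C ∧
      ∀ (u : Euc n → ℝ), MemGag s p u → Function.support u ⊆ closure Ω →
        ∀ δ : ℝ, 0 < δ →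
        (∫ x in ({x ∈ Ω | δ ≤ Metric.infDist x (frontier Ω)} \
                 {x ∈ Ω | 2 * δ ≤ Metric.infDist x (frontier Ω)}), |u x| ^ p) ^ (1/p)
          ≤ C * δ ^ s * gagNorm s p u := by
  obtain ⟨r, hr, hreg⟩ := hΩreg
  have hs0 := hs.1
  have hp0 : 0 < p := by linarith
  have hext := fun x hx => (hreg x hx).2
  set ω : ℝ := volume.real (Metric.ball (0 : Euc n) 1) with hω
  have hω0 : 0 < ω :=
    ENNReal.toReal_pos (Metric.measure_ball_pos _ _ one_pos).ne' measure_ball_lt_top.ne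
  set a : ℝ := (n : ℝ) + s * p with ha
  have ha0 : 0 < a := by positivity
  set C1 : ℝ := (r ^ s)⁻¹ with hC1
  set C2 : ℝ := ((4 : ℝ) ^ a / ω) ^ (1 / p) with hC2
  have hC1p : 0 < C1 := by positivity
  have hC2p : 0 < C2 := by positivity
  refine ⟨1 + C1 + C2, by linarith, ?_⟩
  intro u hu hsupp δ hδ
  obtain ⟨hu1, hu2⟩ := hu
  rw [← ha] at hu2
  unfold gagNorm
  rw [← ha]
  set A : Set (Euc n) := ({x ∈ Ω | δ ≤ Metric.infDist x (frontier Ω)} \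
                 {x ∈ Ω | 2 * δ ≤ Metric.infDist x (frontier Ω)}) with hA
  set F : Euc n × Euc n → ℝ := fun q => |u q.1 - u q.2| ^ p / dist q.1 q.2 ^ a with hF
  have hF0 : ∀ q, 0 ≤ F q := fun q => by simp only [hF]; positivity
  have hu0 : ∀ x, 0 ≤ |u x| ^ p := fun x => by positivity
  have hAm : MeasurableSet A := by
    have hm : ∀ t : ℝ, MeasurableSet {x ∈ Ω | t ≤ Metric.infDist x (frontier Ω)} := fun t =>
      hΩo.measurableSet.inter
        (isClosed_le continuous_const (Metric.continuous_infDist_pt _)).measurableSet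
    exact (hm _).diff (hm _)
  set L : ℝ := ∫ x : Euc n, |u x| ^ p with hL
  set G : ℝ := ∫ q, F q with hG
  have hL0 : 0 ≤ L := integral_nonneg hu0
  have hG0 : 0 ≤ G := integral_nonneg hF0
  have hI0 : 0 ≤ ∫ x in A, |u x| ^ p := integral_nonneg hu0
  have hδs : 0 < δ ^ s := by positivity
  set N : ℝ := (L + G) ^ (1 / p) with hN
  have hN0 : 0 ≤ N := by positivity
  rcases le_or_gt δ r with hδr | hδr
  · -- main case
    have key : (∫ x in A, |u x| ^ p) * (ω * δ ^ n / (4 * δ) ^ a) ≤ G := by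
      have hint : Integrable F (volume.prod volume) := hu2
      have hGG : G = ∫ x, ∫ y, F (x, y) := integral_prod F hint
      have hII := hint.integral_prod_left
      rw [hGG, ← integral_mul_const]
      refine le_trans ?_ (setIntegral_le_integral (s := A) hII
        (Filter.Eventually.of_forall fun x => integral_nonneg fun y => hF0 _))
      refine setIntegral_mono_ae_restrict (hu1.integrableOn.mul_const _) hII.integrableOn ?_
      filter_upwards [ae_restrict_mem hAm, ae_restrict_of_ae hint.prod_right_ae] with x hx hxi
      obtain ⟨⟨hxΩ, h1⟩, h2⟩ := hx
      have h2' : Metric.infDist x (frontier Ω) < 2 * δ := by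
        by_contra h
        exact h2 ⟨hxΩ, not_lt.1 h⟩
      obtain ⟨c, hc, hcd⟩ := exists_ext_ball Ω r hr hext δ hδ hδr x h1 h2'
      have hvol : volume.real (Metric.ball c δ) = ω * δ ^ n := by
        rw [Measure.real, Measure.addHaar_ball_of_pos _ _ hδ, ENNReal.toReal_mul,
          ENNReal.toReal_ofReal (by positivity), finrank_euclideanSpace_fin, mul_comm]
        rfl
      have hle : ∀ y ∈ Metric.ball c δ, |u x| ^ p / (4 * δ) ^ a ≤ F (x, y) := by
        intro y hy
        have hy' := hc hy
        have huy : u y = 0 := by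
          by_contra h
          exact hy' (hsupp h)
        have hxy : x ≠ y := by
          rintro rfl
          exact hy' (subset_closure hxΩ)
        have hd : 0 < dist x y := dist_pos.2 hxy
        simp only [hF, huy, sub_zero]
        have := Real.rpow_le_rpow hd.le (hcd y hy) ha0.le
        have h3 : 0 < dist x y ^ a := by positivity
        exact div_le_div_of_nonneg_left (hu0 x) h3 this
      calc |u x| ^ p * (ω * δ ^ n / (4 * δ) ^ a)
          = ∫ y in Metric.ball c δ, |u x| ^ p / (4 * δ) ^ a := by
            rw [setIntegral_const, hvol, smul_eq_mul]; ring
        _ ≤ ∫ y in Metric.ball c δ, F (x, y) :=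
            setIntegral_mono_on (integrableOn_const measure_ball_lt_top.ne)
              hxi.integrableOn measurableSet_ball hle
        _ ≤ ∫ y, F (x, y) :=
            setIntegral_le_integral hxi (Filter.Eventually.of_forall fun y => hF0 _)
    have hK : ω * δ ^ n / (4 * δ) ^ a = ((4 : ℝ) ^ a / ω * δ ^ (s * p))⁻¹ := by
      have h4 : (4 * δ) ^ a = 4 ^ a * (δ ^ n * δ ^ (s * p)) := by
        rw [Real.mul_rpow (by norm_num) hδ.le, ha, Real.rpow_add hδ, Real.rpow_natCast]
      rw [h4]
      have : 0 < (4 : ℝ) ^ a := by positivity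
      have : 0 < δ ^ (s * p) := by positivity
      field_simp
    rw [hK, ← div_eq_mul_inv, div_le_iff₀ (by positivity)] at key
    have h5 : (∫ x in A, |u x| ^ p) ^ (1 / p) ≤ C2 * δ ^ s * N := by
      calc (∫ x in A, |u x| ^ p) ^ (1 / p)
          ≤ ((4 : ℝ) ^ a / ω * δ ^ (s * p) * (L + G)) ^ (1 / p) := by
            refine Real.rpow_le_rpow hI0 (key.trans ?_) (by positivity)
            rw [mul_comm]
            gcongr
            linarith
        _ = C2 * δ ^ s * N := by
            rw [Real.mul_rpow (by positivity) (by positivity),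
              Real.mul_rpow (by positivity) (by positivity), ← Real.rpow_mul hδ.le]
            congr 3
            field_simp
    refine h5.trans ?_
    gcongr
    linarith
  · have h6 : (∫ x in A, |u x| ^ p) ^ (1 / p) ≤ N := by
      refine Real.rpow_le_rpow hI0 ?_ (by positivity)
      have := setIntegral_le_integral (s := A) hu1 (Filter.Eventually.of_forall hu0)
      linarith
    have h7 : 1 ≤ C1 * δ ^ s := by
      rw [hC1, inv_mul_eq_div, one_le_div (by positivity)]
      exact Real.rpow_le_rpow hr.le hδr.le hs0.le
    calc _ ≤ 1 * N := by rw [one_mul]; exact h6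
      _ ≤ (1 + C1 + C2) * δ ^ s * N := by
        gcongr
        refine h7.trans ?_
        gcongr
        linarith
end
end
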